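/- Let N ≥ 4 be an integer and let p, q, r be distinct partitions of [k] such that cr(p) is the disjoint union of cr(q) and cr(r), with cr(q) and cr(r) both nonempty. Suppose ξ = α₁ ξ_p + α₂ ξ_q + α₃ ξ_r is nonzero. Then ⟨NC, ξ⟩ = P (equality of families meaning equality of each subspace C(k',ℓ')). -/

import Mathlib

open scoped Classical

/-- The block relation of a finite partition of `Fin n` (partition of `[n]`):
`x ∼_p y` iff `x` and `y` lie in the same block of `p`. -/
def PartRel {n : ℕ} (p : Finpartition (Finset.univ : Finset (Fin n))) (x y : Fin n) : Prop :=
  ∃ B ∈ p.parts, x ∈ B ∧ y ∈ B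

/-- `κ` is a crossing of the relation `r`: `κ = {a,b,c,d}` with `a < b < c < d`,
`r a c`, `r b d`, and `¬ r a b`. -/
def IsCross {n : ℕ} (r : Fin n → Fin n → Prop) (κ : Finset (Fin n)) : Prop :=
  ∃ a b c d : Fin n, a < b ∧ b < c ∧ c < d ∧ κ = {a, b, c, d} ∧ r a c ∧ r b d ∧ ¬ r a b

/-- `cr p`: the set of crossings of the partition `p`. -/
def cr {n : ℕ} (p : Finpartition (Finset.univ : Finset (Fin n))) : Set (Finset (Fin n)) :=
  {κ | IsCross (PartRel p) κ}


/-- `crossers p` (`χ(p)`): the union of all crossings of `p`. -/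
def crossers {n : ℕ} (p : Finpartition (Finset.univ : Finset (Fin n))) : Set (Fin n) :=
  {x | ∃ κ ∈ cr p, x ∈ κ}

/-- The vector `ξ_p ∈ (ℂ^N)^{⊗k}`, identified with `(Fin k → Fin N) → ℂ`:
its coordinate at `i` is `1` if `i` is constant on every block of `p`, else `0`. -/
noncomputable def xi (N : ℕ) {k : ℕ} (p : Finpartition (Finset.univ : Finset (Fin k))) :
    (Fin k → Fin N) → ℂ :=
  fun i => if ∀ x y, PartRel p x y → i x = i y then 1 else 0

/-- The span of the noncrossing-partition vectors `ξ_p`, `p ∈ NC(k)`. -/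
noncomputable def ncSpan (N k : ℕ) : Submodule ℂ ((Fin k → Fin N) → ℂ) :=
  Submodule.span ℂ
    {v | ∃ p : Finpartition (Finset.univ : Finset (Fin k)), cr p = ∅ ∧ v = xi N p}

/-- The span of the crossing-partition vectors `ξ_p`, `p ∈ CR(k)`. -/
noncomputable def crSpan (N k : ℕ) : Submodule ℂ ((Fin k → Fin N) → ℂ) :=
  Submodule.span ℂ
    {v | ∃ p : Finpartition (Finset.univ : Finset (Fin k)), (cr p).Nonempty ∧ v = xi N p}

/-- The span of all partition vectors `ξ_p`, `p ∈ P(k)`. -/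
noncomputable def allSpan (N k : ℕ) : Submodule ℂ ((Fin k → Fin N) → ℂ) :=
  Submodule.span ℂ
    {v | ∃ p : Finpartition (Finset.univ : Finset (Fin k)), v = xi N p}

/-- Linear maps `(ℂ^N)^{⊗k} → (ℂ^N)^{⊗ℓ}`, as matrices with rows indexed by
lower index tuples and columns by upper index tuples. -/
abbrev Mat (N k ℓ : ℕ) := Matrix (Fin ℓ → Fin N) (Fin k → Fin N) ℂ

/-- The tensor product of two such linear maps. -/
def tensorMat {N k ℓ k' ℓ' : ℕ} (S : Mat N k ℓ) (T : Mat N k' ℓ') :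
    Mat N (k + k') (ℓ + ℓ') :=
  fun i j =>
    S (fun a => i (Fin.castAdd ℓ' a)) (fun b => j (Fin.castAdd k' b)) *
      T (fun a => i (Fin.natAdd ℓ a)) (fun b => j (Fin.natAdd k b))

/-- The cup: the map `(ℂ^N)^{⊗2} → ℂ` sending `e_i ⊗ e_j` to `δ_{ij}`. -/
def cupMat (N : ℕ) : Mat N 2 0 := fun _ j => if j 0 = j 1 then 1 else 0

/-- A Tannaka–Krein dual at parameter `N`: a family of subspaces
`C k ℓ ⊆ Hom((ℂ^N)^{⊗k}, (ℂ^N)^{⊗ℓ})` closed under tensor products, composition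
and adjoints, containing the identity of `ℂ^N` and the cup. -/
structure TKDual (N : ℕ) where
  C : ∀ k ℓ : ℕ, Submodule ℂ (Mat N k ℓ)
  tensor_mem : ∀ {k ℓ k' ℓ' : ℕ} {S : Mat N k ℓ} {T : Mat N k' ℓ'},
    S ∈ C k ℓ → T ∈ C k' ℓ' → tensorMat S T ∈ C (k + k') (ℓ + ℓ')
  comp_mem : ∀ {k ℓ r : ℕ} {S : Mat N ℓ r} {T : Mat N k ℓ},
    S ∈ C ℓ r → T ∈ C k ℓ → S * T ∈ C k r
  adj_mem : ∀ {k ℓ : ℕ} {T : Mat N k ℓ}, T ∈ C k ℓ → T.conjTranspose ∈ C ℓ k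
  id_mem : (1 : Matrix (Fin 1 → Fin N) (Fin 1 → Fin N) ℂ) ∈ C 1 1
  cup_mem : cupMat N ∈ C 2 0

/-- The involution of `Fin (k + ℓ)` fixing the first `k` (upper) points and
reversing the order of the last `ℓ` (lower) points. -/
def lowerRev (k ℓ : ℕ) : Fin (k + ℓ) → Fin (k + ℓ) :=
  Fin.append (fun a : Fin k => Fin.castAdd ℓ a) (fun a : Fin ℓ => Fin.natAdd k a.rev)

/-- A partition of `[k + ℓ]` (first `k` points upper, last `ℓ` points lower) is
noncrossing when the partition obtained by reversing the order of the lower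
points has no crossing. -/
def IsNCPart {k ℓ : ℕ} (p : Finpartition (Finset.univ : Finset (Fin (k + ℓ)))) : Prop :=
  ∀ κ, ¬ IsCross (fun x y => PartRel p (lowerRev k ℓ x) (lowerRev k ℓ y)) κ

/-- The linear map `T_p : (ℂ^N)^{⊗k} → (ℂ^N)^{⊗ℓ}` of a partition `p` of `[k + ℓ]`:
its entry at (lower tuple `i`, upper tuple `j`) is `1` if the labelling of the points
of `p` by `j` on the upper points and `i` on the lower points is constant on each
block of `p`, and `0` otherwise. -/
noncomputable def Tmat (N : ℕ) (k ℓ : ℕ)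
    (p : Finpartition (Finset.univ : Finset (Fin (k + ℓ)))) : Mat N k ℓ :=
  fun i j => if ∀ x y, PartRel p x y → Fin.append j i x = Fin.append j i y then 1 else 0

/-- The family `P(k,ℓ) = span{T_p : p a partition of [k+ℓ]}`. -/
noncomputable def Pfam (N k ℓ : ℕ) : Submodule ℂ (Mat N k ℓ) :=
  Submodule.span ℂ (Set.range (Tmat N k ℓ))

/-- The family `NC(k,ℓ) = span{T_p : p a noncrossing partition of [k+ℓ]}`. -/
noncomputable def NCfam (N k ℓ : ℕ) : Submodule ℂ (Mat N k ℓ) :=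
  Submodule.span ℂ {T | ∃ p, IsNCPart p ∧ T = Tmat N k ℓ p}

/-- A vector in `(ℂ^N)^{⊗k}` viewed as a linear map `(ℂ^N)^{⊗0} → (ℂ^N)^{⊗k}`. -/
def vecMat {N k : ℕ} (v : (Fin k → Fin N) → ℂ) : Mat N 0 k := fun i _ => v i

/-- `⟨NC, ξ⟩`: the smallest Tannaka–Krein dual containing all of `NC` together with
the vector `ξ ∈ (ℂ^N)^{⊗k}` (in degree `(0,k)`), i.e. the intersection of all such. -/
noncomputable def genNCxi (N : ℕ) {k : ℕ} (ξ : (Fin k → Fin N) → ℂ) (k' ℓ' : ℕ) :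
    Submodule ℂ (Mat N k' ℓ') :=
  ⨅ (C : TKDual N) (_ : ∀ a b, NCfam N a b ≤ C.C a b) (_ : vecMat ξ ∈ C.C 0 k),
    C.C k' ℓ'


/-! ### Counting functions that are constant on the classes of a setoid -/

section Counting

open Finset

variable {α β : Type*} [Fintype α] {N : ℕ}

/-- The functions `α → Fin N` that are constant on the classes of `s`. -/
noncomputable def constFns (N : ℕ) (s : Setoid α) : Finset (α → Fin N) :=
  univ.filter fun i => s ≤ Setoid.ker i

theorem mem_constFns {s : Setoid α} {i : α → Fin N} : i ∈ constFns N s ↔ s ≤ Setoid.ker i := by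
  simp [constFns]

theorem constFns_card_pos [NeZero N] (s : Setoid α) : 0 < #(constFns N s) :=
  card_pos.2 ⟨fun _ => 0, mem_constFns.2 fun _ _ _ => rfl⟩

/-- The number of extensions along `f` of a function to a function constant on the classes
of `s` does not depend on the function, as long as there is one. -/
theorem card_constFns_fiber [NeZero N] [Fintype β] (s : Setoid α) (f : β → α) (j : β → Fin N) :
    #{i ∈ constFns N s | i ∘ f = j} =
      if Setoid.comap f s ≤ Setoid.ker j then #{i ∈ constFns N s | i ∘ f = 0} else 0 := by
  split_ifs with h
  · obtain ⟨e, he, hej⟩ : ∃ e : α → Fin N, s ≤ Setoid.ker e ∧ e ∘ f = j := by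
      have key : ∀ z b, s z (f b) → (if h : ∃ b, s z (f b) then j h.choose else 0) = j b := by
        intro z b hb
        have h' : ∃ b, s z (f b) := ⟨b, hb⟩
        rw [dif_pos h']
        exact h (s.trans (s.symm h'.choose_spec) hb)
      refine ⟨fun z => if h : ∃ b, s z (f b) then j h.choose else 0, ?_, ?_⟩
      · intro x y hxy
        show dite _ _ _ = dite _ _ _
        by_cases hy : ∃ b, s y (f b)
        · obtain ⟨b, hb⟩ := hy
          rw [key y b hb, key x b (s.trans hxy hb)]
        · have hx : ¬ ∃ b, s x (f b) := fun ⟨b, hb⟩ => hy ⟨b, s.trans (s.symm hxy) hb⟩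
          rw [dif_neg hx, dif_neg hy]
      · funext b
        exact key (f b) b (s.refl _)
    refine card_bij' (fun i _ => i - e) (fun i _ => i + e) ?_ ?_ ?_ ?_
    · intro i hi
      simp only [mem_filter, mem_constFns] at hi ⊢
      refine ⟨fun x y hxy => ?_, ?_⟩
      · have h1 : i x = i y := hi.1 hxy
        have h2 : e x = e y := he hxy
        simp [Setoid.ker_def, h1, h2]
      · funext b
        have h1 := congrFun hi.2 b
        have h2 := congrFun hej b
        simp only [Function.comp_apply] at h1 h2
        simp [h1, h2]
    · intro i hi
      simp only [mem_filter, mem_constFns] at hi ⊢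
      refine ⟨fun x y hxy => ?_, ?_⟩
      · have h1 : i x = i y := hi.1 hxy
        have h2 : e x = e y := he hxy
        simp [Setoid.ker_def, h1, h2]
      · funext b
        have h1 := congrFun hi.2 b
        have h2 := congrFun hej b
        simp only [Function.comp_apply] at h1 h2
        simp [h1, h2]
    · intro i _; simp
    · intro i _; simp
  · rw [card_eq_zero, filter_eq_empty_iff]
    rintro i hi rfl
    exact h fun a b hab => mem_constFns.1 hi hab

theorem card_constFns_eq_mul [NeZero N] [Fintype β] (s : Setoid α) (f : β → α) :
    #(constFns N s) =
      #{i ∈ constFns N s | i ∘ f = 0} * #(constFns N (Setoid.comap f s)) := by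
  have h1 : #(constFns N s) = ∑ j : β → Fin N, #{i ∈ constFns N s | i ∘ f = j} :=
    card_eq_sum_card_fiberwise (f := fun i => i ∘ f) (t := univ) (by simp)
  rw [h1, sum_congr rfl fun j _ => card_constFns_fiber s f j, ← sum_filter, sum_const,
    smul_eq_mul, mul_comm]
  rfl

/-- The smallest setoid identifying `x` and `y`. -/
def pairSetoid {α : Type*} (x y : α) : Setoid α := Relation.EqvGen.setoid fun u v => u = x ∧ v = y

theorem pairSetoid_le {α : Type*} {x y : α} {s : Setoid α} : pairSetoid x y ≤ s ↔ s x y :=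
  ⟨fun h => h (Relation.EqvGen.rel _ _ ⟨rfl, rfl⟩),
    fun h => Setoid.eqvGen_le (by rintro _ _ ⟨rfl, rfl⟩; exact h)⟩

theorem sup_pairSetoid_of_rel {α : Type*} {x y : α} {s : Setoid α} (h : s x y) :
    s ⊔ pairSetoid x y = s :=
  sup_eq_left.2 (pairSetoid_le.2 h)

theorem card_constFns_sup_pair [NeZero N] {x y : α} {s : Setoid α} (h : ¬ s x y) :
    #(constFns N s) = N * #(constFns N (s ⊔ pairSetoid x y)) := by
  have h1 : #(constFns N s) =
      ∑ c : Fin N, #{i ∈ constFns N s | i x - i y = c} := by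
    rw [card_eq_sum_card_fiberwise (s := constFns N s) (f := fun i : α → Fin N => i x - i y)
      (t := univ) fun _ _ => mem_coe.2 (mem_univ _)]
  suffices h2 : ∀ c : Fin N, #{i ∈ constFns N s | i x - i y = c} =
      #(constFns N (s ⊔ pairSetoid x y)) by
    rw [h1, sum_congr rfl fun c _ => h2 c, sum_const, card_univ, Fintype.card_fin, smul_eq_mul]
  intro c
  have hy : ¬ s y x := fun h' => h (s.symm h')
  have hcon : ∀ u v, s u v → (s u x ↔ s v x) := fun u v huv =>
    ⟨fun hu => s.trans (s.symm huv) hu, fun hv => s.trans huv hv⟩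
  refine card_bij' (fun i _ z => if s z x then i z - c else i z)
    (fun i _ z => if s z x then i z + c else i z) ?_ ?_ ?_ ?_
  · intro i hi
    simp only [mem_filter, mem_constFns, sup_le_iff, pairSetoid_le] at hi ⊢
    refine ⟨fun u v huv => ?_, ?_⟩
    · have h1 : i u = i v := hi.1 huv
      simp [Setoid.ker_def, h1, hcon u v huv]
    · have := hi.2
      simp only [Setoid.ker_def, s.refl x, hy, if_true, if_false]
      rw [← this]; abel
  · intro i hi
    simp only [mem_filter, mem_constFns, sup_le_iff, pairSetoid_le] at hi ⊢
    refine ⟨fun u v huv => ?_, ?_⟩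
    · have h1 : i u = i v := hi.1 huv
      simp [Setoid.ker_def, h1, hcon u v huv]
    · have := hi.2
      simp only [Setoid.ker_def] at this
      simp only [s.refl x, hy, if_true, if_false]
      rw [← this]; abel
  · intro i _
    funext z
    by_cases hz : s z x <;> simp [hz]
  · intro i _
    funext z
    by_cases hz : s z x <;> simp [hz]

end Counting

/-! ### Partitions of `Fin n` and setoids on `Fin n` -/

section Partitions

/-- The setoid whose classes are the blocks of `p`. -/
def partSetoid {n : ℕ} (p : Finpartition (Finset.univ : Finset (Fin n))) : Setoid (Fin n) where
  r := PartRel p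
  iseqv := by
    refine ⟨fun x => ?_, ?_, ?_⟩
    · obtain ⟨B, hB, hx⟩ := p.exists_mem (Finset.mem_univ x)
      exact ⟨B, hB, hx, hx⟩
    · rintro x y ⟨B, hB, hx, hy⟩
      exact ⟨B, hB, hy, hx⟩
    · rintro x y z ⟨B, hB, hx, hy⟩ ⟨B', hB', hy', hz⟩
      obtain rfl := p.eq_of_mem_parts hB hB' hy hy'
      exact ⟨B, hB, hx, hz⟩

theorem partRel_ofSetoid {n : ℕ} (s : Setoid (Fin n)) (x y : Fin n) :
    PartRel (Finpartition.ofSetoid s) x y ↔ s x y := by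
  rw [← Finpartition.mem_part_ofSetoid_iff_rel (s := s)]
  constructor
  · rintro ⟨B, hB, hx, hy⟩
    rwa [Finpartition.part_eq_of_mem _ hB hx]
  · intro h
    exact ⟨_, Finpartition.part_mem _ |>.2 (Finset.mem_univ x),
      Finpartition.mem_part _ (Finset.mem_univ x), h⟩

theorem partSetoid_ofSetoid {n : ℕ} (s : Setoid (Fin n)) :
    partSetoid (Finpartition.ofSetoid s) = s :=
  Setoid.ext fun x y => partRel_ofSetoid s x y

theorem xi_apply {N k : ℕ} (p : Finpartition (Finset.univ : Finset (Fin k))) (i : Fin k → Fin N) :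
    xi N p i = if partSetoid p ≤ Setoid.ker i then 1 else 0 :=
  if_congr ⟨fun h x y => h x y, fun h x y => @h x y⟩ rfl rfl

theorem Tmat_apply {N k l : ℕ} (p : Finpartition (Finset.univ : Finset (Fin (k + l))))
    (j : Fin l → Fin N) (i : Fin k → Fin N) :
    Tmat N k l p j i = if partSetoid p ≤ Setoid.ker (Fin.append i j) then 1 else 0 :=
  if_congr ⟨fun h x y => h x y, fun h x y => @h x y⟩ rfl rfl

/-- The matrix of a setoid on `k` upper and `l` lower points. -/
noncomputable def setoidMat (N k l : ℕ) (s : Setoid (Fin (k + l))) : Mat N k l :=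
  fun j i => if s ≤ Setoid.ker (Fin.append i j) then 1 else 0

theorem setoidMat_eq_Tmat {N k l : ℕ} (s : Setoid (Fin (k + l))) :
    setoidMat N k l s = Tmat N k l (Finpartition.ofSetoid s) := by
  funext j i
  rw [Tmat_apply, partSetoid_ofSetoid, setoidMat]

theorem Tmat_eq_setoidMat {N k l : ℕ} (p : Finpartition (Finset.univ : Finset (Fin (k + l)))) :
    Tmat N k l p = setoidMat N k l (partSetoid p) := by
  funext j i
  rw [Tmat_apply, setoidMat]

end Partitions

/-! ### The spans of all partition matrices form a Tannaka–Krein dual -/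

section PfamDual

open Finset

variable {N : ℕ}

theorem setoidMat_mem_Pfam {k l : ℕ} (s : Setoid (Fin (k + l))) :
    setoidMat N k l s ∈ Pfam N k l := by
  rw [setoidMat_eq_Tmat]
  exact Submodule.subset_span ⟨_, rfl⟩

/-- A matrix whose entries indicate that the indices are constant along a relation is a
partition matrix. -/
theorem mem_Pfam_of_rel {k l : ℕ} (ρ : Fin (k + l) → Fin (k + l) → Prop)
    {P : (Fin l → Fin N) → (Fin k → Fin N) → Prop} [∀ j i, Decidable (P j i)] {M : Mat N k l}
    (hM : ∀ j i, M j i = if P j i then 1 else 0)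
    (hP : ∀ j i, P j i ↔ ∀ x y, ρ x y → Fin.append i j x = Fin.append i j y) :
    M ∈ Pfam N k l := by
  have : M = setoidMat N k l (Relation.EqvGen.setoid ρ) := by
    funext j i
    rw [hM, setoidMat]
    refine if_congr ((hP j i).trans ?_) rfl rfl
    exact ⟨fun h => Setoid.eqvGen_le h, fun h x y hxy => h (Relation.EqvGen.rel _ _ hxy)⟩
  exact this ▸ setoidMat_mem_Pfam _

theorem setoidMat_mul_mem_Pfam [NeZero N] {k l r : ℕ} (s : Setoid (Fin (l + r)))
    (t : Setoid (Fin (k + l))) : setoidMat N l r s * setoidMat N k l t ∈ Pfam N k r := by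
  let ιt : Fin (k + l) → Fin k ⊕ (Fin l ⊕ Fin r) :=
    Fin.append Sum.inl fun x => Sum.inr (Sum.inl x)
  let ιs : Fin (l + r) → Fin k ⊕ (Fin l ⊕ Fin r) :=
    Fin.append (fun x => Sum.inr (Sum.inl x)) fun x => Sum.inr (Sum.inr x)
  let f : Fin (k + r) → Fin k ⊕ (Fin l ⊕ Fin r) :=
    Fin.append Sum.inl fun x => Sum.inr (Sum.inr x)
  let u : Setoid (Fin k ⊕ (Fin l ⊕ Fin r)) :=
    Relation.EqvGen.setoid fun x y =>
      (∃ a b, s a b ∧ x = ιs a ∧ y = ιs b) ∨ ∃ a b, t a b ∧ x = ιt a ∧ y = ιt b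
  have hu : ∀ g : Fin k ⊕ (Fin l ⊕ Fin r) → Fin N, u ≤ Setoid.ker g ↔
      s ≤ Setoid.ker (g ∘ ιs) ∧ t ≤ Setoid.ker (g ∘ ιt) := by
    intro g
    constructor
    · exact fun h => ⟨fun a b hab => h (Relation.EqvGen.rel _ _ (Or.inl ⟨a, b, hab, rfl, rfl⟩)),
        fun a b hab => h (Relation.EqvGen.rel _ _ (Or.inr ⟨a, b, hab, rfl, rfl⟩))⟩
    · rintro ⟨h1, h2⟩
      apply Setoid.eqvGen_le
      rintro _ _ (⟨a, b, hab, rfl, rfl⟩ | ⟨a, b, hab, rfl, rfl⟩)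
      · exact h1 hab
      · exact h2 hab
  have hs : ∀ (i : Fin k → Fin N) (m : Fin l → Fin N) (j : Fin r → Fin N),
      Sum.elim i (Sum.elim m j) ∘ ιs = Fin.append m j := by
    intro i m j
    funext x
    refine Fin.addCases (fun x => ?_) (fun x => ?_) x <;> simp [ιs]
  have ht : ∀ (i : Fin k → Fin N) (m : Fin l → Fin N) (j : Fin r → Fin N),
      Sum.elim i (Sum.elim m j) ∘ ιt = Fin.append i m := by
    intro i m j
    funext x
    refine Fin.addCases (fun x => ?_) (fun x => ?_) x <;> simp [ιt]
  have hf : ∀ (i : Fin k → Fin N) (m : Fin l → Fin N) (j : Fin r → Fin N),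
      Sum.elim i (Sum.elim m j) ∘ f = Fin.append i j := by
    intro i m j
    funext x
    refine Fin.addCases (fun x => ?_) (fun x => ?_) x <;> simp [f]
  have key : setoidMat N l r s * setoidMat N k l t =
      (#{g ∈ constFns N u | g ∘ f = 0} : ℂ) • setoidMat N k r (Setoid.comap f u) := by
    funext j i
    have h1 : #{g ∈ constFns N u | g ∘ f = Fin.append i j} =
        #{m : Fin l → Fin N |
          s ≤ Setoid.ker (Fin.append m j) ∧ t ≤ Setoid.ker (Fin.append i m)} := by
      symm
      refine card_bij (fun m _ => Sum.elim i (Sum.elim m j)) ?_ ?_ ?_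
      · intro m hm
        simp only [mem_filter, mem_univ, true_and] at hm
        simp only [mem_filter, mem_constFns, hu, hs, ht, hf, hm, and_self]
      · intro m _ m' _ h
        funext x
        exact congrFun h (Sum.inr (Sum.inl x))
      · intro g hg
        simp only [mem_filter, mem_constFns, hu] at hg
        have hgi : i = fun x => g (Sum.inl x) := by
          funext x
          have := congrFun hg.2 (Fin.castAdd r x)
          simpa [f] using this.symm
        have hgj : j = fun x => g (Sum.inr (Sum.inr x)) := by
          funext x
          have := congrFun hg.2 (Fin.natAdd k x)
          simpa [f] using this.symm
        have hg' : Sum.elim i (Sum.elim (fun x => g (Sum.inr (Sum.inl x))) j) = g := by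
          subst hgi hgj
          funext x
          rcases x with x | x | x <;> rfl
        refine ⟨fun x => g (Sum.inr (Sum.inl x)), ?_, hg'⟩
        simp only [mem_filter, mem_univ, true_and]
        rw [← hs i, ← ht i _ j, hg']
        exact hg.1
    have h2 := card_constFns_fiber u f (Fin.append i j)
    rw [h1] at h2
    have h3 : (setoidMat N l r s * setoidMat N k l t) j i =
        (#{m : Fin l → Fin N | s ≤ Setoid.ker (Fin.append m j) ∧
          t ≤ Setoid.ker (Fin.append i m)} : ℂ) := by
      rw [Matrix.mul_apply, card_filter, Nat.cast_sum]
      refine sum_congr rfl fun m _ => ?_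
      simp only [setoidMat]
      by_cases ha : s ≤ Setoid.ker (Fin.append m j) <;>
        by_cases hb : t ≤ Setoid.ker (Fin.append i m) <;> simp [ha, hb]
    rw [h3, h2, Matrix.smul_apply, setoidMat]
    split_ifs <;> simp
  rw [key]
  exact Submodule.smul_mem _ _ (setoidMat_mem_Pfam _)

theorem setoidMat_tensor_mem_Pfam {k l k' l' : ℕ} (s : Setoid (Fin (k + l)))
    (t : Setoid (Fin (k' + l'))) :
    tensorMat (setoidMat N k l s) (setoidMat N k' l' t) ∈ Pfam N (k + k') (l + l') := by
  let ιs : Fin (k + l) → Fin (k + k' + (l + l')) :=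
    Fin.append (fun x => Fin.castAdd _ (Fin.castAdd _ x)) fun x => Fin.natAdd _ (Fin.castAdd _ x)
  let ιt : Fin (k' + l') → Fin (k + k' + (l + l')) :=
    Fin.append (fun x => Fin.castAdd _ (Fin.natAdd _ x)) fun x => Fin.natAdd _ (Fin.natAdd _ x)
  have hs : ∀ (j : Fin (l + l') → Fin N) (i : Fin (k + k') → Fin N),
      Fin.append (fun b => i (Fin.castAdd k' b)) (fun a => j (Fin.castAdd l' a)) =
      Fin.append i j ∘ ιs := by
    intro j i
    funext x
    refine Fin.addCases (fun x => ?_) (fun x => ?_) x <;> simp [ιs]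
  have ht : ∀ (j : Fin (l + l') → Fin N) (i : Fin (k + k') → Fin N),
      Fin.append (fun b => i (Fin.natAdd k b)) (fun a => j (Fin.natAdd l a)) =
      Fin.append i j ∘ ιt := by
    intro j i
    funext x
    refine Fin.addCases (fun x => ?_) (fun x => ?_) x <;> simp [ιt]
  refine mem_Pfam_of_rel
    (fun x y => (∃ a b, s a b ∧ x = ιs a ∧ y = ιs b) ∨ ∃ a b, t a b ∧ x = ιt a ∧ y = ιt b)
    (P := fun j i => s ≤ Setoid.ker (Fin.append i j ∘ ιs) ∧ t ≤ Setoid.ker (Fin.append i j ∘ ιt))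
    (fun j i => ?_) (fun j i => ⟨?_, fun h => ?_⟩)
  · simp only [tensorMat, setoidMat, hs, ht]
    rw [ite_and]
    split_ifs <;> simp
  · rintro ⟨h1, h2⟩ _ _ (⟨a, b, hab, rfl, rfl⟩ | ⟨a, b, hab, rfl, rfl⟩)
    · exact h1 hab
    · exact h2 hab
  · exact ⟨fun a b hab => h _ _ (Or.inl ⟨a, b, hab, rfl, rfl⟩),
      fun a b hab => h _ _ (Or.inr ⟨a, b, hab, rfl, rfl⟩)⟩

theorem setoidMat_conjTranspose_mem_Pfam {k l : ℕ} (s : Setoid (Fin (k + l))) :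
    (setoidMat N k l s).conjTranspose ∈ Pfam N l k := by
  let ι : Fin (k + l) → Fin (l + k) := Fin.append (Fin.natAdd l) (Fin.castAdd k)
  have hs : ∀ (j : Fin k → Fin N) (i : Fin l → Fin N),
      Fin.append j i = Fin.append i j ∘ ι := by
    intro j i
    funext x
    refine Fin.addCases (fun x => ?_) (fun x => ?_) x <;> simp [ι]
  refine mem_Pfam_of_rel (fun x y => ∃ a b, s a b ∧ x = ι a ∧ y = ι b)
    (P := fun j i => s ≤ Setoid.ker (Fin.append i j ∘ ι)) (fun j i => ?_)
    (fun j i => ⟨?_, fun h => ?_⟩)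
  · rw [Matrix.conjTranspose_apply, setoidMat, hs, apply_ite star, star_one, star_zero]
  · rintro h _ _ ⟨a, b, hab, rfl, rfl⟩
    exact h hab
  · exact fun a b hab => h _ _ ⟨a, b, hab, rfl, rfl⟩

theorem Pfam_induction {k l : ℕ} {p : Mat N k l → Prop} (hs : ∀ s, p (setoidMat N k l s))
    (h0 : p 0) (hadd : ∀ x y, p x → p y → p (x + y)) (hsmul : ∀ (a : ℂ) x, p x → p (a • x))
    {M : Mat N k l} (hM : M ∈ Pfam N k l) : p M := by
  refine Submodule.span_induction ?_ h0 (fun x y _ _ => hadd x y) (fun a x _ => hsmul a x) hM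
  rintro _ ⟨q, rfl⟩
  rw [Tmat_eq_setoidMat]
  exact hs _

theorem tensorMat_mem_Pfam {k l k' l' : ℕ} {S : Mat N k l} {T : Mat N k' l'}
    (hS : S ∈ Pfam N k l) (hT : T ∈ Pfam N k' l') :
    tensorMat S T ∈ Pfam N (k + k') (l + l') := by
  refine Pfam_induction (p := fun S => tensorMat S T ∈ Pfam N (k + k') (l + l'))
    (fun s => ?_) ?_ (fun x y hx hy => ?_) (fun a x hx => ?_) hS
  · refine Pfam_induction (p := fun T => tensorMat _ T ∈ Pfam N (k + k') (l + l'))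
      (fun t => setoidMat_tensor_mem_Pfam s t) ?_ (fun x y hx hy => ?_) (fun a x hx => ?_) hT
    · convert Submodule.zero_mem _
      funext j i
      simp [tensorMat]
    · convert Submodule.add_mem _ hx hy using 1
      funext j i
      simp [tensorMat, mul_add]
    · convert Submodule.smul_mem _ a hx using 1
      funext j i
      simp [tensorMat, mul_left_comm]
  · convert Submodule.zero_mem _
    funext j i
    simp [tensorMat]
  · convert Submodule.add_mem _ hx hy using 1
    funext j i
    simp [tensorMat, add_mul]
  · convert Submodule.smul_mem _ a hx using 1
    funext j i
    simp [tensorMat, mul_assoc]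

theorem mul_mem_Pfam [NeZero N] {k l r : ℕ} {S : Mat N l r} {T : Mat N k l}
    (hS : S ∈ Pfam N l r) (hT : T ∈ Pfam N k l) : S * T ∈ Pfam N k r := by
  refine Pfam_induction (p := fun S => S * T ∈ Pfam N k r)
    (fun s => ?_) ?_ (fun x y hx hy => ?_) (fun a x hx => ?_) hS
  · refine Pfam_induction (p := fun T => _ * T ∈ Pfam N k r)
      (fun t => setoidMat_mul_mem_Pfam s t) ?_ (fun x y hx hy => ?_) (fun a x hx => ?_) hT
    · rw [Matrix.mul_zero]; exact Submodule.zero_mem _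
    · rw [Matrix.mul_add]; exact Submodule.add_mem _ hx hy
    · rw [Matrix.mul_smul]; exact Submodule.smul_mem _ a hx
  · rw [Matrix.zero_mul]; exact Submodule.zero_mem _
  · rw [Matrix.add_mul]; exact Submodule.add_mem _ hx hy
  · rw [Matrix.smul_mul]; exact Submodule.smul_mem _ a hx

theorem conjTranspose_mem_Pfam {k l : ℕ} {T : Mat N k l} (hT : T ∈ Pfam N k l) :
    T.conjTranspose ∈ Pfam N l k := by
  refine Pfam_induction (p := fun T => T.conjTranspose ∈ Pfam N l k)
    (fun t => setoidMat_conjTranspose_mem_Pfam t) ?_ (fun x y hx hy => ?_) (fun a x hx => ?_) hT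
  · rw [Matrix.conjTranspose_zero]; exact Submodule.zero_mem _
  · rw [Matrix.conjTranspose_add]; exact Submodule.add_mem _ hx hy
  · rw [Matrix.conjTranspose_smul]; exact Submodule.smul_mem _ _ hx

/-- The family `P` as a Tannaka–Krein dual. -/
noncomputable def pfamDual (N : ℕ) [NeZero N] : TKDual N where
  C := Pfam N
  tensor_mem := tensorMat_mem_Pfam
  comp_mem := mul_mem_Pfam
  adj_mem := conjTranspose_mem_Pfam
  id_mem := by
    refine mem_Pfam_of_rel (fun x y => x = Fin.castAdd 1 0 ∧ y = Fin.natAdd 1 0)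
      (fun j i => Matrix.one_apply) (fun j i => ⟨?_, fun h => ?_⟩)
    · rintro rfl _ _ ⟨rfl, rfl⟩
      rw [Fin.append_left, Fin.append_right]
    · have := h _ _ ⟨rfl, rfl⟩
      rw [Fin.append_left, Fin.append_right] at this
      funext x
      rw [Subsingleton.elim x 0, this]
  cup_mem := by
    refine mem_Pfam_of_rel (fun x y => x = Fin.castAdd 0 0 ∧ y = Fin.castAdd 0 1)
      (fun j i => rfl) (fun j i => ⟨?_, fun h => ?_⟩)
    · rintro h _ _ ⟨rfl, rfl⟩
      rwa [Fin.append_left, Fin.append_left]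
    · have := h _ _ ⟨rfl, rfl⟩
      rwa [Fin.append_left, Fin.append_left] at this

theorem NCfam_le_Pfam (k l : ℕ) : NCfam N k l ≤ Pfam N k l :=
  Submodule.span_mono (by rintro _ ⟨p, _, rfl⟩; exact ⟨p, rfl⟩)

theorem vecMat_xi_mem_Pfam {k : ℕ} (p : Finpartition (Finset.univ : Finset (Fin k))) :
    vecMat (xi N p) ∈ Pfam N 0 k := by
  refine mem_Pfam_of_rel
    (fun x y => ∃ a b, PartRel p a b ∧ x = Fin.natAdd 0 a ∧ y = Fin.natAdd 0 b)
    (fun j i => rfl) (fun j i => ⟨?_, fun h => ?_⟩)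
  · rintro h _ _ ⟨a, b, hab, rfl, rfl⟩
    rw [Fin.append_right, Fin.append_right]
    exact h a b hab
  · intro a b hab
    have := h _ _ ⟨a, b, hab, rfl, rfl⟩
    rwa [Fin.append_right, Fin.append_right] at this

end PfamDual

/-! ### Operations available in a Tannaka–Krein dual containing `NC` -/

section Operations

variable {N : ℕ}

theorem setoidMat_mem_NCfam {k l : ℕ} {s : Setoid (Fin (k + l))}
    (hs : ∀ a b c d : Fin (k + l), a < b → b < c → c < d →
      s (lowerRev k l a) (lowerRev k l c) → s (lowerRev k l b) (lowerRev k l d) →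
        s (lowerRev k l a) (lowerRev k l b)) :
    setoidMat N k l s ∈ NCfam N k l := by
  rw [setoidMat_eq_Tmat]
  refine Submodule.subset_span ⟨_, ?_, rfl⟩
  rintro κ ⟨a, b, c, d, hab, hbc, hcd, -, hac, hbd, hnab⟩
  rw [partRel_ofSetoid] at hac hbd
  exact hnab ((partRel_ofSetoid s _ _).2 (hs a b c d hab hbc hcd hac hbd))

/-- The vector of a setoid. -/
noncomputable def setoidVec (N : ℕ) {k : ℕ} (s : Setoid (Fin k)) : (Fin k → Fin N) → ℂ :=
  fun i => if s ≤ Setoid.ker i then 1 else 0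

theorem xi_eq_setoidVec {k : ℕ} (p : Finpartition (Finset.univ : Finset (Fin k))) :
    xi N p = setoidVec N (partSetoid p) :=
  funext fun i => xi_apply p i

/-- A setoid on four points has at most one crossing: the one of the chords `02` and `13`. -/
theorem vecMat_setoidVec_mem_NCfam {u : Setoid (Fin 4)} (hu : ¬ (u 0 2 ∧ u 1 3 ∧ ¬ u 0 1)) :
    vecMat (setoidVec N u) ∈ NCfam N 0 4 := by
  have h : vecMat (setoidVec N u) = setoidMat N 0 4 u := by
    funext j i
    have : Fin.append i j = j := by
      funext x
      fin_cases x <;> rfl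
    rw [setoidMat, this]
    rfl
  rw [h]
  refine setoidMat_mem_NCfam fun (a b c d : Fin 4) hab hbc hcd hac hbd => ?_
  obtain rfl : a = 0 := by omega
  obtain rfl : b = 1 := by omega
  obtain rfl : c = 2 := by omega
  obtain rfl : d = 3 := by omega
  have h0 : lowerRev 0 4 (0 : Fin 4) = (3 : Fin 4) := by decide
  have h1 : lowerRev 0 4 (1 : Fin 4) = (2 : Fin 4) := by decide
  have h2 : lowerRev 0 4 (2 : Fin 4) = (1 : Fin 4) := by decide
  have h3 : lowerRev 0 4 (3 : Fin 4) = (0 : Fin 4) := by decide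
  rw [h0, h2] at hac
  rw [h1, h3] at hbd
  rw [h0, h1]
  have h01 : u 0 1 := by
    by_contra hn
    exact hu ⟨u.symm hbd, u.symm hac, hn⟩
  exact u.trans hac (u.trans (u.symm h01) (u.symm hbd))

/-- The map restricting the index tuple along `f`, summing over all other indices. -/
noncomputable def selectMat (N : ℕ) {m n : ℕ} (f : Fin m → Fin n) : Mat N n m :=
  fun j i => if i ∘ f = j then 1 else 0

theorem selectMat_mul_apply {k m n : ℕ} (f : Fin m → Fin n) (M : Mat N k n) (j : Fin m → Fin N)
    (i : Fin k → Fin N) :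
    (selectMat N f * M) j i = ∑ t : Fin n → Fin N, if t ∘ f = j then M t i else 0 := by
  rw [Matrix.mul_apply]
  exact Finset.sum_congr rfl fun t _ => by simp [selectMat]

/-- The map acting by `B` on the tensor factors `a` and `b`. -/
noncomputable def localMat {N n : ℕ} (B : Mat N 2 2) (a b : Fin n) : Mat N n n :=
  fun j i => if ∀ z, z ≠ a → z ≠ b → j z = i z then B ![j a, j b] ![i a, i b] else 0

variable {C : TKDual N}

theorem one_zero_mem (hC : ∀ a b, NCfam N a b ≤ C.C a b) : (1 : Mat N 0 0) ∈ C.C 0 0 := by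
  have h : (1 : Mat N 0 0) = setoidMat N 0 0 ⊥ := by
    funext j i
    rw [setoidMat, if_pos bot_le, Subsingleton.elim j i, Matrix.one_apply_eq]
  rw [h]
  exact hC _ _ (setoidMat_mem_NCfam fun a => a.elim0)

theorem selectMat_mem (hC : ∀ a b, NCfam N a b ≤ C.C a b)
    {m n : ℕ} {f : Fin m → Fin n} (hf : StrictMono f) :
    selectMat N f ∈ C.C n m := by
  induction n generalizing m with
  | zero =>
    obtain rfl : m = 0 := by
      rcases m with _ | m
      · rfl
      · exact (f 0).elim0
    have h : selectMat N f = 1 := by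
      funext j i
      rw [selectMat, if_pos (Subsingleton.elim _ _), Subsingleton.elim j i, Matrix.one_apply_eq]
    rw [h]
    exact one_zero_mem hC
  | succ n ih =>
    by_cases hl : ∃ a, f a = Fin.last n
    · obtain ⟨a, ha⟩ := hl
      rcases m with _ | m
      · exact a.elim0
      have hlt : ∀ x : Fin m, (f x.castSucc : ℕ) < n := fun x => by
        have h1 : f x.castSucc < f (Fin.last m) := hf (Fin.castSucc_lt_last x)
        have := (f (Fin.last m)).isLt
        rw [Fin.lt_def] at h1
        omega
      have hlast : f (Fin.last m) = Fin.last n :=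
        le_antisymm (Fin.le_last _) (ha ▸ hf.monotone (Fin.le_last a))
      have h : selectMat N f =
          tensorMat (selectMat N fun x : Fin m => (⟨f x.castSucc, hlt x⟩ : Fin n))
            (1 : Mat N 1 1) := by
        funext j i
        simp only [tensorMat, selectMat, Matrix.one_apply, ← ite_and, mul_one, mul_ite, mul_zero]
        refine if_congr ⟨?_, fun ⟨h1, h2⟩ => ?_⟩ rfl rfl
        · rintro rfl
          refine ⟨?_, rfl⟩
          funext x
          rw [Subsingleton.elim x 0]
          exact congrArg i hlast
        · funext x
          refine Fin.lastCases ?_ (fun x => ?_) x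
          · have := congrFun h1 0
            rw [Function.comp_apply, hlast]
            exact this.symm
          · exact congrFun h2 x
      rw [h]
      refine C.tensor_mem (ih ?_) C.id_mem
      intro x y hxy
      exact hf (Fin.castSucc_lt_castSucc_iff.2 hxy)
    · have hlt : ∀ x : Fin m, (f x : ℕ) < n := fun x => by
        have h1 : f x ≠ Fin.last n := fun h => hl ⟨x, h⟩
        exact Fin.val_lt_last h1
      have h : selectMat N f =
          tensorMat (ℓ := m) (k' := 1) (ℓ' := 0)
            (selectMat N fun x : Fin m => (⟨f x, hlt x⟩ : Fin n))
            (setoidMat N 1 0 ⊥) := by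
        funext j i
        simp only [tensorMat, selectMat, setoidMat, if_pos bot_le, mul_one]
        rfl
      rw [h]
      refine C.tensor_mem (k := n) (ℓ := m) (k' := 1) (ℓ' := 0) (ih ?_)
        (hC 1 0 (setoidMat_mem_NCfam ?_))
      · exact fun x y hxy => hf hxy
      · intro a b c d hab
        omega

theorem one_mem (hC : ∀ a b, NCfam N a b ≤ C.C a b) (n : ℕ) : (1 : Mat N n n) ∈ C.C n n := by
  have h : (1 : Mat N n n) = selectMat N (id : Fin n → Fin n) := by
    funext j i
    rw [Matrix.one_apply, selectMat]
    exact if_congr eq_comm rfl rfl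
  rw [h]
  exact selectMat_mem hC strictMono_id

theorem localMat_mem (hC : ∀ a b, NCfam N a b ≤ C.C a b)
    {n : ℕ} {B : Mat N 2 2} (hB : B ∈ C.C 2 2) {a b : Fin n}
    (hab : (b : ℕ) = a + 1) : localMat B a b ∈ C.C n n := by
  induction n with
  | zero => exact a.elim0
  | succ n ih =>
    by_cases hb : (b : ℕ) = n
    · obtain ⟨n, rfl⟩ : ∃ n', n = n' + 1 := ⟨a, by omega⟩
      have ha' : a = Fin.natAdd n (0 : Fin 2) := Fin.ext (by simp; omega)
      have hb' : b = Fin.natAdd n (1 : Fin 2) := Fin.ext (by simp; omega)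
      have h : localMat B a b = tensorMat (k' := 2) (ℓ' := 2) (1 : Mat N n n) B := by
        funext j i
        simp only [tensorMat, localMat, Matrix.one_apply, ite_mul, one_mul, zero_mul]
        subst ha' hb'
        refine if_congr ⟨fun h => ?_, fun h z hz hz' => ?_⟩ ?_ rfl
        · funext x
          refine h _ (fun hx => ?_) (fun hx => ?_) <;>
          · have := congrArg Fin.val hx
            simp at this
            omega
        · have : (z : ℕ) < n := by
            simp only [ne_eq, Fin.ext_iff, Fin.val_natAdd] at hz hz'
            have := z.isLt
            simp at hz hz'
            omega
          exact congrFun h ⟨z, this⟩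
        · congr 1 <;>
          · funext x
            fin_cases x <;> rfl
      rw [h]
      exact C.tensor_mem (one_mem hC n) hB
    · have hb' : (b : ℕ) < n := by omega
      have ha' : (a : ℕ) < n := by omega
      have h : localMat B a b =
          tensorMat (localMat B (⟨a, ha'⟩ : Fin n) ⟨b, hb'⟩) (1 : Mat N 1 1) := by
        funext j i
        simp only [tensorMat, localMat, Matrix.one_apply, mul_one, mul_ite, mul_zero]
        rw [← ite_and]
        refine if_congr ⟨fun h => ⟨?_, ?_⟩, fun ⟨h1, h2⟩ z hz hz' => ?_⟩ rfl rfl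
        · funext x
          refine h _ (fun hx => ?_) (fun hx => ?_) <;>
          · have := congrArg Fin.val hx
            simp at this
            omega
        · intro z hz hz'
          exact h _ (fun hx => hz (Fin.ext (by simpa using congrArg Fin.val hx)))
            (fun hx => hz' (Fin.ext (by simpa using congrArg Fin.val hx)))
        · induction z using Fin.lastCases with
          | last => exact congrFun h1 0
          | cast z =>
            exact h2 z (fun hx => hz (Fin.ext (by simpa using congrArg Fin.val hx)))
              (fun hx => hz' (Fin.ext (by simpa using congrArg Fin.val hx)))
      rw [h]
      exact C.tensor_mem (ih (by simpa using hab)) C.id_mem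

/-- The diagonal map projecting on the tuples with equal neighbouring indices. -/
theorem diagonal_adjacent_mem (hC : ∀ a b, NCfam N a b ≤ C.C a b)
    {n : ℕ} {a b : Fin n} (hab : (b : ℕ) = a + 1) :
    Matrix.diagonal (fun i : Fin n → Fin N => if i a = i b then (1 : ℂ) else 0) ∈ C.C n n := by
  have h : Matrix.diagonal (fun i : Fin n → Fin N => if i a = i b then (1 : ℂ) else 0) =
      localMat (setoidMat N 2 2 ⊤) a b := by
    funext j i
    simp only [Matrix.diagonal_apply, localMat, setoidMat]
    rw [← ite_and, ← ite_and]
    refine if_congr ⟨?_, fun ⟨h1, h2⟩ => ?_⟩ rfl rfl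
    · rintro ⟨rfl, h⟩
      refine ⟨fun _ _ _ => rfl, fun x y _ => ?_⟩
      have key : ∀ x, Fin.append ![j a, j b] ![j a, j b] x = j a := by
        intro x
        fin_cases x
        · rfl
        · exact h.symm
        · rfl
        · exact h.symm
      exact (key x).trans (key y).symm
    · have h02 : i a = j a := h2 (x := (0 : Fin 4)) (y := (2 : Fin 4)) trivial
      have h13 : i b = j b := h2 (x := (1 : Fin 4)) (y := (3 : Fin 4)) trivial
      have h23 : j a = j b := h2 (x := (2 : Fin 4)) (y := (3 : Fin 4)) trivial
      refine ⟨?_, h23⟩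
      funext z
      by_cases ha : z = a
      · rw [ha, h02]
      by_cases hb : z = b
      · rw [hb, h13]
      exact h1 z ha hb
  rw [h]
  exact localMat_mem hC (hC _ _ (setoidMat_mem_NCfam fun _ _ _ _ _ _ _ _ _ => trivial)) hab

end Operations

/-! ### Generating all partition matrices from the crossing of two chords -/

section Generation

variable {N : ℕ}

/-- The crossing of the chords `02` and `13`. -/
def crossSetoid : Setoid (Fin 4) := pairSetoid 0 2 ⊔ pairSetoid 1 3

theorem setoidVec_crossSetoid (i : Fin 4 → Fin N) :
    setoidVec N crossSetoid i = if i 0 = i 2 ∧ i 1 = i 3 then 1 else 0 :=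
  if_congr (by rw [crossSetoid, sup_le_iff, pairSetoid_le, pairSetoid_le]; rfl) rfl rfl

theorem selectMat_mul_selectMat {l m n : ℕ} (f : Fin l → Fin m) (g : Fin m → Fin n) :
    selectMat N f * selectMat N g = selectMat N (g ∘ f) := by
  funext j i
  rw [selectMat_mul_apply, Finset.sum_eq_single (i ∘ g) (fun t _ ht => ?_) (by simp)]
  · simp only [selectMat, if_true, Function.comp_assoc]
  · simp only [selectMat]
    rw [if_neg (Ne.symm ht), ite_self]

theorem selectMat_id {n : ℕ} : selectMat N (id : Fin n → Fin n) = 1 := by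
  funext j i
  rw [Matrix.one_apply, selectMat]
  exact if_congr eq_comm rfl rfl

theorem diagonal_mul_selectMat {m n : ℕ} (f : Fin m → Fin n) (d : (Fin m → Fin N) → ℂ) :
    Matrix.diagonal d * selectMat N f =
      selectMat N f * Matrix.diagonal (fun i => d (i ∘ f)) := by
  funext j i
  rw [Matrix.diagonal_mul, Matrix.mul_diagonal, selectMat]
  split_ifs with h
  · rw [h, mul_comm]
  · simp

theorem localMat_swap {n : ℕ} (a b : Fin n) :
    localMat (selectMat N ⇑(Equiv.swap (0 : Fin 2) 1)) a b =
      selectMat N ⇑(Equiv.swap a b) := by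
  funext j i
  simp only [localMat, selectMat, ← ite_and]
  refine if_congr ⟨fun ⟨h1, h2⟩ => ?_, ?_⟩ rfl rfl
  · have h20 : i b = j a := by simpa using congrFun h2 0
    have h21 : i a = j b := by simpa using congrFun h2 1
    funext z
    rw [Function.comp_apply]
    by_cases hza : z = a
    · rw [hza, Equiv.swap_apply_left, h20]
    by_cases hzb : z = b
    · rw [hzb, Equiv.swap_apply_right, h21]
    rw [Equiv.swap_apply_of_ne_of_ne hza hzb, h1 z hza hzb]
  · rintro rfl
    refine ⟨fun z hza hzb => ?_, ?_⟩
    · rw [Function.comp_apply, Equiv.swap_apply_of_ne_of_ne hza hzb]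
    · funext x
      fin_cases x <;> simp

variable {C : TKDual N}

theorem selectMat_swap_mem (hC : ∀ a b, NCfam N a b ≤ C.C a b)
    (hX : vecMat (setoidVec N crossSetoid) ∈ C.C 0 4) :
    selectMat N ⇑(Equiv.swap (0 : Fin 2) 1) ∈ C.C 2 2 := by
  have hw : tensorMat (tensorMat (1 : Mat N 1 1) (vecMat (setoidVec N crossSetoid)))
      (1 : Mat N 1 1) ∈ C.C 2 6 := C.tensor_mem (C.tensor_mem C.id_mem hX) C.id_mem
  have h := C.comp_mem (selectMat_mem hC (f := ![(2 : Fin 6), 3]) (by decide))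
    (C.comp_mem (diagonal_adjacent_mem hC (a := (0 : Fin 6)) (b := 1) rfl)
      (C.comp_mem (diagonal_adjacent_mem hC (a := (4 : Fin 6)) (b := 5) rfl) hw))
  convert h using 1
  funext j i
  rw [selectMat_mul_apply]
  simp only [Matrix.diagonal_mul, tensorMat, vecMat, setoidVec_crossSetoid, Matrix.one_apply]
  simp only [mul_ite, mul_one, mul_zero, ← ite_and]
  rw [Finset.sum_eq_single ![i 0, i 0, i 1, i 0, i 1, i 1] (fun t _ ht => if_neg ?_) (by simp)]
  · rw [selectMat]
    refine if_congr ?_ rfl rfl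
    constructor
    · rintro rfl
      refine ⟨?_, ⟨⟨?_, ⟨rfl, rfl⟩, ?_⟩, rfl⟩, rfl⟩
      all_goals
        funext x
        fin_cases x <;> rfl
    · rintro ⟨rfl, -⟩
      funext x
      fin_cases x <;> rfl
  · rintro ⟨-, ⟨⟨h5, ⟨h13, h24⟩, h0⟩, h45⟩, h01⟩
    refine ht (funext fun x => ?_)
    have e5 : t 5 = i 1 := congrFun h5 0
    have e0 : t 0 = i 0 := congrFun h0 0
    have e13 : t 1 = t 3 := h13
    have e24 : t 2 = t 4 := h24
    fin_cases x
    · exact e0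
    · exact h01.symm.trans e0
    · exact e24.trans (h45.trans e5)
    · exact e13.symm.trans (h01.symm.trans e0)
    · exact h45.trans e5
    · exact e5

theorem selectMat_perm_mem (hC : ∀ a b, NCfam N a b ≤ C.C a b)
    (hX : vecMat (setoidVec N crossSetoid) ∈ C.C 0 4)
    {n : ℕ} (σ : Equiv.Perm (Fin n)) : selectMat N ⇑σ ∈ C.C n n := by
  rcases n with _ | n
  · exact selectMat_mem hC fun a => a.elim0
  have hσ : σ ∈ Submonoid.closure
      (Set.range fun i : Fin n => Equiv.swap i.castSucc i.succ) := by
    rw [Equiv.Perm.mclosure_swap_castSucc_succ]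
    trivial
  induction hσ using Submonoid.closure_induction with
  | mem τ hτ =>
    obtain ⟨i, rfl⟩ := hτ
    rw [← localMat_swap]
    exact localMat_mem hC (selectMat_swap_mem hC hX) (by simp)
  | one => exact selectMat_mem hC strictMono_id
  | mul τ τ' _ _ hτ hτ' =>
    rw [Equiv.Perm.coe_mul, ← selectMat_mul_selectMat]
    exact C.comp_mem hτ' hτ

theorem diagonal_pair_mem (hC : ∀ a b, NCfam N a b ≤ C.C a b)
    (hX : vecMat (setoidVec N crossSetoid) ∈ C.C 0 4)
    {n : ℕ} (x y : Fin n) :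
    Matrix.diagonal (fun i : Fin n → Fin N => if i x = i y then (1 : ℂ) else 0) ∈ C.C n n := by
  by_cases hxy : x = y
  · simp only [hxy, if_true, Matrix.diagonal_one]
    exact one_mem hC n
  have hn : 1 < n := by omega
  let a : Fin n := ⟨0, by omega⟩
  let b : Fin n := ⟨1, hn⟩
  have hab : b ≠ a := Fin.ne_of_val_ne (by simp [a, b])
  let σ : Equiv.Perm (Fin n) := Equiv.swap (Equiv.swap a x b) y * Equiv.swap a x
  have hb : σ b = y := by simp [σ]
  have ha : σ a = x := by
    have h : x ≠ Equiv.swap a x b := by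
      intro h
      rw [eq_comm, ← Equiv.eq_symm_apply, Equiv.symm_swap, Equiv.swap_apply_right] at h
      exact hab h
    simp only [σ, Equiv.Perm.mul_apply, Equiv.swap_apply_left]
    exact Equiv.swap_apply_of_ne_of_ne h hxy
  have h := C.comp_mem (selectMat_perm_mem hC hX σ.symm)
    (C.comp_mem (diagonal_adjacent_mem hC (a := a) (b := b) rfl) (selectMat_perm_mem hC hX σ))
  rw [diagonal_mul_selectMat, ← Matrix.mul_assoc, selectMat_mul_selectMat,
    Equiv.self_comp_symm, selectMat_id, Matrix.one_mul] at h
  simpa only [Function.comp_apply, ha, hb] using h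

theorem diagonal_setoid_mem (hC : ∀ a b, NCfam N a b ≤ C.C a b)
    (hX : vecMat (setoidVec N crossSetoid) ∈ C.C 0 4)
    {n : ℕ} (s : Setoid (Fin n)) :
    Matrix.diagonal (fun i : Fin n → Fin N => if s ≤ Setoid.ker i then (1 : ℂ) else 0) ∈
      C.C n n := by
  have key : ∀ S : Finset (Fin n × Fin n), Matrix.diagonal
      (fun i : Fin n → Fin N => if ∀ z ∈ S, i z.1 = i z.2 then (1 : ℂ) else 0) ∈ C.C n n := by
    intro S
    induction S using Finset.induction_on with
    | empty => simpa using one_mem hC n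
    | insert z S _ ih =>
      have h := C.comp_mem (diagonal_pair_mem hC hX z.1 z.2) ih
      rw [Matrix.diagonal_mul_diagonal] at h
      refine (congrArg (· ∈ C.C n n) (congrArg Matrix.diagonal (funext fun i => ?_))).mpr h
      rw [ite_mul, one_mul, zero_mul, ← ite_and]
      exact if_congr (Finset.forall_mem_insert _ _ _) rfl rfl
  convert key (Finset.univ.filter fun z => s z.1 z.2) using 3 with i
  refine if_congr ⟨fun h z hz => h (Finset.mem_filter.1 hz).2, fun h x y hxy => ?_⟩ rfl rfl
  exact h (x, y) (Finset.mem_filter.2 ⟨Finset.mem_univ _, hxy⟩)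

theorem setoidMat_mem (hC : ∀ a b, NCfam N a b ≤ C.C a b)
    (hX : vecMat (setoidVec N crossSetoid) ∈ C.C 0 4)
    {k l : ℕ} (s : Setoid (Fin (k + l))) : setoidMat N k l s ∈ C.C k l := by
  have h := C.comp_mem (selectMat_mem hC (Fin.strictMono_natAdd (m := l) k))
    (C.comp_mem (diagonal_setoid_mem hC hX s)
      (C.adj_mem (selectMat_mem hC (Fin.strictMono_castAdd (n := k) l))))
  convert h using 1
  funext j i
  rw [selectMat_mul_apply, Finset.sum_eq_single (Fin.append i j) (fun t _ ht => ?_) (by simp)]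
  · have hr : Fin.append i j ∘ Fin.natAdd k = j := funext fun x => Fin.append_right i j x
    have hl : Fin.append i j ∘ Fin.castAdd l = i := funext fun x => Fin.append_left i j x
    rw [if_pos hr, Matrix.diagonal_mul, Matrix.conjTranspose_apply, selectMat, if_pos hl,
      star_one, mul_one, setoidMat]
  · rw [ite_eq_right_iff]
    rintro rfl
    have hl : t ∘ Fin.castAdd l ≠ i := by
      rintro rfl
      exact ht (Fin.append_castAdd_natAdd (f := t)).symm
    rw [Matrix.diagonal_mul, Matrix.conjTranspose_apply, selectMat, if_neg hl, star_zero, mul_zero]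

theorem Pfam_le (hC : ∀ a b, NCfam N a b ≤ C.C a b)
    (hX : vecMat (setoidVec N crossSetoid) ∈ C.C 0 4)
    (k l : ℕ) : Pfam N k l ≤ C.C k l :=
  Submodule.span_le.2 (by
    rintro _ ⟨p, rfl⟩
    rw [Tmat_eq_setoidMat]
    exact setoidMat_mem hC hX _)

end Generation

/-! ### Identifying and forgetting legs of a vector -/

section Legs

variable {N : ℕ} {C : TKDual N}

theorem sum_fiber_ite {ι κ : Type*} [Fintype ι] [DecidableEq κ] (F : ι → κ) (v : ι → ℂ)
    (P : κ → Prop) [DecidablePred P] (t : κ) :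
    (if P t then ∑ i, if F i = t then v i else 0 else 0) =
      ∑ i, if F i = t then (if P (F i) then v i else 0) else 0 := by
  split_ifs with h
  · exact Finset.sum_congr rfl fun i _ => if_ctx_congr Iff.rfl (fun hi => by rw [hi, if_pos h])
      fun _ => rfl
  · refine (Finset.sum_eq_zero fun i _ => ?_).symm
    split_ifs with hi hP
    · exact absurd (hi ▸ hP) h
    · rfl
    · rfl

/-- The points `x, y ∈ S` are equal or neighbours in the cyclic order of `S`. -/
def CycAdj {k : ℕ} (S : Finset (Fin k)) (x y : Fin k) : Prop :=
  x = y ∨ (x < y ∧ ∀ z ∈ S, z ≤ x ∨ y ≤ z) ∨ (y < x ∧ ∀ z ∈ S, z ≤ y ∨ x ≤ z) ∨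
    (∀ z ∈ S, x ≤ z ∧ z ≤ y) ∨ ∀ z ∈ S, y ≤ z ∧ z ≤ x

theorem vecMat_nest_mem {n : ℕ} {v : (Fin n → Fin N) → ℂ} (hv : vecMat v ∈ C.C 0 n) :
    vecMat (fun u : Fin (1 + n + 1) → Fin N =>
      if u (Fin.castAdd 1 (Fin.castAdd n 0)) = u (Fin.natAdd (1 + n) 0) then
        v (fun x => u (Fin.castAdd 1 (Fin.natAdd 1 x))) else 0) ∈ C.C 0 (1 + n + 1) := by
  have h : tensorMat (tensorMat (1 : Mat N 1 1) (vecMat v)) (1 : Mat N 1 1) ∈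
      C.C 2 (1 + n + 1) := C.tensor_mem (C.tensor_mem C.id_mem hv) C.id_mem
  convert C.comp_mem h (C.adj_mem C.cup_mem) using 1
  funext u i
  rw [Matrix.mul_apply, Finset.sum_eq_single
    ![u (Fin.castAdd 1 (Fin.castAdd n 0)), u (Fin.natAdd (1 + n) 0)] (fun t _ ht => ?_) (by simp)]
  · have e1 : (1 : Mat N 1 1) (fun a => u (Fin.castAdd 1 (Fin.castAdd n a)))
        (fun b => ![u (Fin.castAdd 1 (Fin.castAdd n 0)), u (Fin.natAdd (1 + n) 0)]
          (Fin.castAdd 1 (Fin.castAdd 0 b) : Fin (1 + 0 + 1))) = 1 := by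
      rw [Matrix.one_apply, if_pos]
      funext x
      fin_cases x
      rfl
    have e2 : (1 : Mat N 1 1) (fun a => u (Fin.natAdd (1 + n) a))
        (fun b => ![u (Fin.castAdd 1 (Fin.castAdd n 0)), u (Fin.natAdd (1 + n) 0)]
          (Fin.natAdd (1 + 0) b : Fin (1 + 0 + 1))) = 1 := by
      rw [Matrix.one_apply, if_pos]
      funext x
      fin_cases x
      rfl
    simp only [tensorMat]
    rw [e1, e2]
    by_cases h : u (Fin.castAdd 1 (Fin.castAdd n 0)) = u (Fin.natAdd (1 + n) 0) <;>
      simp [cupMat, vecMat, h]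
  · simp only [tensorMat, Matrix.one_apply]
    by_contra hne
    refine ht (funext fun x => ?_)
    simp only [mul_eq_zero, not_or, ite_eq_right_iff, Classical.not_imp] at hne
    obtain ⟨⟨⟨⟨h1, -⟩, -⟩, h2, -⟩, -⟩ := hne
    fin_cases x
    · exact (congrFun h1 0).symm
    · exact (congrFun h2 0).symm

theorem vecMat_select_mem (hC : ∀ a b, NCfam N a b ≤ C.C a b)
    {m n : ℕ} {f : Fin m → Fin n} (hf : StrictMono f)
    {v : (Fin n → Fin N) → ℂ} (hv : vecMat v ∈ C.C 0 n) :
    vecMat (fun j : Fin m → Fin N => ∑ i : Fin n → Fin N, if i ∘ f = j then v i else 0) ∈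
      C.C 0 m := by
  convert C.comp_mem (selectMat_mem hC hf) hv using 1
  funext j i
  rw [selectMat_mul_apply]
  rfl

theorem vecMat_adjacent_mem (hC : ∀ a b, NCfam N a b ≤ C.C a b)
    {n : ℕ} {a b : Fin n} (hab : (b : ℕ) = a + 1)
    {v : (Fin n → Fin N) → ℂ} (hv : vecMat v ∈ C.C 0 n) :
    vecMat (fun i : Fin n → Fin N => if i a = i b then v i else 0) ∈ C.C 0 n := by
  convert C.comp_mem (diagonal_adjacent_mem hC hab) hv using 1
  funext j i
  rw [Matrix.diagonal_mul, ite_mul, one_mul, zero_mul]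
  rfl

theorem vecMat_wrap_mem (hC : ∀ a b, NCfam N a b ≤ C.C a b)
    {n : ℕ} {a b : Fin n} (ha : (a : ℕ) = 0) (hb : (b : ℕ) + 1 = n)
    {v : (Fin n → Fin N) → ℂ} (hv : vecMat v ∈ C.C 0 n) :
    vecMat (fun i : Fin n → Fin N => if i a = i b then v i else 0) ∈ C.C 0 n := by
  let g : Fin n → Fin (1 + n + 1) := fun x => Fin.castAdd 1 (Fin.natAdd 1 x)
  have hg : StrictMono g := fun x y h => by
    rw [Fin.lt_def] at h
    change 1 + (x : ℕ) < 1 + (y : ℕ)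
    omega
  have h := vecMat_select_mem hC hg
    (vecMat_adjacent_mem hC (a := Fin.castAdd 1 (Fin.castAdd n 0)) (b := g a)
      (by change 1 + (a : ℕ) = 0 + 1; omega)
    (vecMat_adjacent_mem hC (a := g b) (b := Fin.natAdd (1 + n) 0)
      (by change 1 + n + 0 = 1 + (b : ℕ) + 1; omega)
    (vecMat_nest_mem hv)))
  convert h using 2
  funext j
  rw [Finset.sum_eq_single (Fin.append (Fin.append (fun _ => j a) j) fun _ => j b)
    (fun t _ ht => ?_) (by simp)]
  · have e : ∀ x, (Fin.append (Fin.append (fun _ : Fin 1 => j a) j) fun _ : Fin 1 => j b) (g x) =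
        j x := fun x => by simp only [g]; rw [Fin.append_left, Fin.append_right]
    have he : (Fin.append (Fin.append (fun _ : Fin 1 => j a) j) fun _ : Fin 1 => j b) ∘ g = j :=
      funext e
    rw [if_pos he, e, e, Fin.append_left, Fin.append_left, Fin.append_right, if_pos rfl,
      if_pos rfl]
    refine if_congr Iff.rfl ?_ rfl
    exact congrArg v he.symm
  · by_contra hne
    simp only [ite_eq_right_iff, Classical.not_imp] at hne
    obtain ⟨rfl, h1, h2, -⟩ := hne
    refine ht (funext fun x => ?_)
    refine Fin.addCases (fun x => Fin.addCases (fun x => ?_) (fun x => ?_) x) (fun x => ?_) x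
    · rw [Fin.append_right, Subsingleton.elim x 0]
      exact h2.symm
    · rw [Fin.append_left, Fin.append_left, Subsingleton.elim x 0]
      exact h1
    · rw [Fin.append_left, Fin.append_right]
      rfl

theorem vecMat_cycAdj_mem (hC : ∀ a b, NCfam N a b ≤ C.C a b)
    {n : ℕ} {a b : Fin n} (hab : CycAdj Finset.univ a b)
    {v : (Fin n → Fin N) → ℂ} (hv : vecMat v ∈ C.C 0 n) :
    vecMat (fun i : Fin n → Fin N => if i a = i b then v i else 0) ∈ C.C 0 n := by
  have hsucc : ∀ a b : Fin n, a < b → (∀ z ∈ Finset.univ, z ≤ a ∨ b ≤ z) →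
      (b : ℕ) = a + 1 := by
    intro a b hlt h
    have h1 := h ⟨a + 1, by omega⟩ (Finset.mem_univ _)
    simp only [Fin.le_def] at h1
    omega
  have hends : ∀ a b : Fin n, (∀ z ∈ Finset.univ, a ≤ z ∧ z ≤ b) →
      (a : ℕ) = 0 ∧ (b : ℕ) + 1 = n := by
    intro a b h
    have hn : 0 < n := a.pos
    have h1 := (h ⟨0, hn⟩ (Finset.mem_univ _)).1
    have h2 := (h ⟨n - 1, by omega⟩ (Finset.mem_univ _)).2
    simp only [Fin.le_def] at h1 h2
    omega
  rcases hab with rfl | ⟨hlt, h⟩ | ⟨hlt, h⟩ | h | h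
  · simpa using hv
  · exact vecMat_adjacent_mem hC (hsucc _ _ hlt h) hv
  · simpa only [eq_comm] using vecMat_adjacent_mem hC (hsucc _ _ hlt h) hv
  · exact vecMat_wrap_mem hC (hends _ _ h).1 (hends _ _ h).2 hv
  · simpa only [eq_comm] using vecMat_wrap_mem hC (hends _ _ h).1 (hends _ _ h).2 hv

theorem vecMat_identify_mem (hC : ∀ a b, NCfam N a b ≤ C.C a b)
    {k m : ℕ} {v : (Fin k → Fin N) → ℂ} (hv : vecMat v ∈ C.C 0 k)
    {S : Finset (Fin k)} {f : Fin m → Fin k} (hf : StrictMono f) (hfS : ∀ x, f x ∈ S)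
    {x₁ y₁ x₂ y₂ : Fin k} (hx₁ : x₁ ∈ S) (hy₁ : y₁ ∈ S) (hx₂ : x₂ ∈ S) (hy₂ : y₂ ∈ S)
    (h₁ : CycAdj S x₁ y₁) (h₂ : CycAdj S x₂ y₂) :
    vecMat (fun j : Fin m → Fin N => ∑ i : Fin k → Fin N,
      if i ∘ f = j ∧ i x₁ = i y₁ ∧ i x₂ = i y₂ then v i else 0) ∈ C.C 0 m := by
  let e := S.orderEmbOfFin rfl
  have hmem : ∀ x, e x ∈ S := fun x => S.orderEmbOfFin_mem rfl x
  have hsurj : ∀ x ∈ S, ∃ x', e x' = x := by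
    intro x hx
    have : x ∈ Set.range e := by rw [Finset.range_orderEmbOfFin]; exact hx
    exact this
  have hadj : ∀ x y, CycAdj S (e x) (e y) → CycAdj Finset.univ x y := by
    rintro x y (h | ⟨h, h'⟩ | ⟨h, h'⟩ | h' | h')
    · exact Or.inl (e.injective h)
    · exact Or.inr (Or.inl ⟨e.lt_iff_lt.1 h, fun z _ =>
        (h' _ (hmem z)).imp e.le_iff_le.1 e.le_iff_le.1⟩)
    · exact Or.inr (Or.inr (Or.inl ⟨e.lt_iff_lt.1 h, fun z _ =>
        (h' _ (hmem z)).imp e.le_iff_le.1 e.le_iff_le.1⟩))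
    · exact Or.inr (Or.inr (Or.inr (Or.inl fun z _ =>
        (h' _ (hmem z)).imp e.le_iff_le.1 e.le_iff_le.1)))
    · exact Or.inr (Or.inr (Or.inr (Or.inr fun z _ =>
        (h' _ (hmem z)).imp e.le_iff_le.1 e.le_iff_le.1)))
  choose f' hf' using fun x => hsurj _ (hfS x)
  obtain ⟨x₁, rfl⟩ := hsurj _ hx₁
  obtain ⟨y₁, rfl⟩ := hsurj _ hy₁
  obtain ⟨x₂, rfl⟩ := hsurj _ hx₂
  obtain ⟨y₂, rfl⟩ := hsurj _ hy₂
  have hmono : StrictMono f' := fun x y h => by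
    rw [← e.lt_iff_lt, hf', hf']
    exact hf h
  have h := vecMat_select_mem hC hmono (vecMat_cycAdj_mem hC (hadj _ _ h₁)
    (vecMat_cycAdj_mem hC (hadj _ _ h₂) (vecMat_select_mem hC e.strictMono hv)))
  convert h using 2
  funext j
  simp only [← ite_and]
  refine Eq.trans ?_ (Finset.sum_congr rfl fun t _ => (sum_fiber_ite (· ∘ e) v
    (fun t => t ∘ f' = j ∧ t x₁ = t y₁ ∧ t x₂ = t y₂) t).symm)
  rw [Finset.sum_comm]
  refine Finset.sum_congr rfl fun i _ => ?_
  rw [Finset.sum_ite_eq, if_pos (Finset.mem_univ _)]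
  have hff : (i ∘ e) ∘ f' = i ∘ f := by
    rw [Function.comp_assoc]
    exact congrArg (i ∘ ·) (funext hf')
  rw [hff]
  rfl

end Legs

/-! ### The linear relation detected by a pair of chords -/

section Chords

variable {N : ℕ}

/-- The chords `ac` and `bd` lie in different classes of `s`. -/
def Chords {α : Type*} (s : Setoid α) (a b c d : α) : Prop := s a c ∧ s b d ∧ ¬ s a b

theorem Chords.rotate {α : Type*} {s : Setoid α} {a b c d : α} (h : Chords s a b c d) :
    Chords s b c d a :=
  ⟨h.2.1, s.symm h.1, fun hbc => h.2.2 (s.trans h.1 (s.symm hbc))⟩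

theorem chords_rotate {α : Type*} {s : Setoid α} {a b c d : α} :
    Chords s b c d a ↔ Chords s a b c d :=
  ⟨fun h => h.rotate.rotate.rotate, Chords.rotate⟩

/-- `a, b, c, d` are distinct and in this order up to rotation. -/
def CycOrdered {k : ℕ} (a b c d : Fin k) : Prop :=
  (a < b ∧ b < c ∧ c < d) ∨ (b < c ∧ c < d ∧ d < a) ∨ (c < d ∧ d < a ∧ a < b) ∨
    (d < a ∧ a < b ∧ b < c)

/-- The set `s ⊔ (x₁ y₁) ⊔ (x₂ y₂)` of identifications. -/
def identify {α : Type*} (s : Setoid α) (x₁ y₁ x₂ y₂ : α) : Setoid α :=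
  s ⊔ pairSetoid x₁ y₁ ⊔ pairSetoid x₂ y₂

theorem identify_le {α : Type*} {s t : Setoid α} {x₁ y₁ x₂ y₂ : α} :
    identify s x₁ y₁ x₂ y₂ ≤ t ↔ s ≤ t ∧ t x₁ y₁ ∧ t x₂ y₂ := by
  rw [identify, sup_le_iff, sup_le_iff, pairSetoid_le, pairSetoid_le, and_assoc]

theorem eq_crossSetoid {u : Setoid (Fin 4)} (hu : Chords u 0 1 2 3) : u = crossSetoid := by
  obtain ⟨h02, h13, h01⟩ := hu
  refine le_antisymm ?_ (sup_le (pairSetoid_le.2 h02) (pairSetoid_le.2 h13))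
  have c02 : crossSetoid 0 2 := pairSetoid_le.1 le_sup_left
  have c13 : crossSetoid 1 3 := pairSetoid_le.1 le_sup_right
  have h03 : ¬ u 0 3 := fun h => h01 (u.trans h (u.symm h13))
  have h12 : ¬ u 1 2 := fun h => h01 (u.trans h02 (u.symm h))
  have h23 : ¬ u 2 3 := fun h => h03 (u.trans h02 h)
  have key : ∀ x y, x < y → u x y → crossSetoid x y := by
    intro x y hxy h
    fin_cases x <;> fin_cases y <;>
      first | exact absurd hxy (by decide) | contradiction | assumption
  intro x y h
  rcases lt_trichotomy x y with hxy | rfl | hxy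
  · exact key x y hxy h
  · exact crossSetoid.refl _
  · exact crossSetoid.symm (key y x hxy (u.symm h))

theorem sum_identify [NeZero N] {k m : ℕ} (s : Setoid (Fin k)) (x₁ y₁ x₂ y₂ : Fin k)
    (f : Fin m → Fin k) (j : Fin m → Fin N) :
    (∑ i : Fin k → Fin N,
      if i ∘ f = j ∧ i x₁ = i y₁ ∧ i x₂ = i y₂ then setoidVec N s i else 0) =
      (((constFns N (identify s x₁ y₁ x₂ y₂)).filter fun i => i ∘ f = 0).card : ℂ) *
        setoidVec N (Setoid.comap f (identify s x₁ y₁ x₂ y₂)) j := by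
  have h := card_constFns_fiber (N := N) (identify s x₁ y₁ x₂ y₂) f j
  have hset : ((constFns N (identify s x₁ y₁ x₂ y₂)).filter fun i => i ∘ f = j) =
      Finset.univ.filter fun i => (i ∘ f = j ∧ i x₁ = i y₁ ∧ i x₂ = i y₂) ∧ s ≤ Setoid.ker i := by
    ext i
    rw [Finset.mem_filter, mem_constFns, Finset.mem_filter, identify_le]
    exact ⟨fun h => ⟨Finset.mem_univ _, ⟨h.2, h.1.2⟩, h.1.1⟩, fun h => ⟨⟨h.2.2, h.2.1.2⟩, h.2.1.1⟩⟩
  rw [setoidVec, mul_ite, mul_one, mul_zero, ← Nat.cast_zero (R := ℂ), ← Nat.cast_ite, ← h, hset,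
    Finset.card_filter, Nat.cast_sum]
  refine Finset.sum_congr rfl fun i _ => ?_
  rw [setoidVec, Nat.cast_ite, Nat.cast_one, Nat.cast_zero, ← ite_and]

/-- The vectors contained in a Tannaka–Krein dual. -/
def vecs (C : TKDual N) (k : ℕ) : Submodule ℂ ((Fin k → Fin N) → ℂ) where
  carrier := {v | vecMat v ∈ C.C 0 k}
  add_mem' h h' := (C.C 0 k).add_mem h h'
  zero_mem' := (C.C 0 k).zero_mem
  smul_mem' a _ h := (C.C 0 k).smul_mem a h

variable {C : TKDual N} {ι : Type*} [Fintype ι]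

theorem sum_chords_eq_zero (hC : ∀ a b, NCfam N a b ≤ C.C a b)
    (hX : setoidVec N crossSetoid ∉ vecs C 4)
    {c : ι → ℂ} {u : ι → Setoid (Fin 4)}
    (h : (∑ m, c m • setoidVec N (u m)) ∈ vecs C 4) :
    (∑ m, if Chords (u m) 0 1 2 3 then c m else 0) = 0 := by
  by_contra hne
  have h1 : (∑ m, if Chords (u m) 0 1 2 3 then c m else 0) • setoidVec N crossSetoid ∈
      vecs C 4 := by
    have h2 : (∑ m, if Chords (u m) 0 1 2 3 then 0 else c m • setoidVec N (u m)) ∈ vecs C 4 :=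
      Submodule.sum_mem _ fun m _ => by
        split_ifs with hm
        · exact Submodule.zero_mem _
        · exact Submodule.smul_mem _ _ (hC _ _ (vecMat_setoidVec_mem_NCfam hm))
    convert Submodule.sub_mem _ h h2 using 1
    rw [← Finset.sum_sub_distrib, Finset.sum_smul]
    refine Finset.sum_congr rfl fun m _ => ?_
    split_ifs with hm
    · rw [eq_crossSetoid hm, sub_zero]
    · rw [zero_smul, sub_self]
  exact hX ((Submodule.smul_mem_iff _ hne).1 h1)

theorem sum_chords_identify_of_lt (hC : ∀ a b, NCfam N a b ≤ C.C a b)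
    (hX : setoidVec N crossSetoid ∉ vecs C 4)
    [NeZero N] {k : ℕ} {α : ι → ℂ} {s : ι → Setoid (Fin k)}
    (h : (∑ m, α m • setoidVec N (s m)) ∈ vecs C k) {a b c d x₁ y₁ x₂ y₂ : Fin k}
    (hab : a < b) (hbc : b < c) (hcd : c < d)
    (h₁ : CycAdj {a, b, c, d, x₁, y₁, x₂, y₂} x₁ y₁)
    (h₂ : CycAdj {a, b, c, d, x₁, y₁, x₂, y₂} x₂ y₂) :
    (∑ m, if Chords (identify (s m) x₁ y₁ x₂ y₂) a b c d then
      α m * (constFns N (identify (s m) x₁ y₁ x₂ y₂)).card else 0) = 0 := by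
  let f : Fin 4 → Fin k := ![a, b, c, d]
  have hf : StrictMono f := by
    rw [Fin.strictMono_iff_lt_succ]
    intro i
    fin_cases i
    · exact hab
    · exact hbc
    · exact hcd
  have hfS : ∀ x, f x ∈ ({a, b, c, d, x₁, y₁, x₂, y₂} : Finset (Fin k)) := by
    intro x
    fin_cases x <;> simp [f]
  have h3 := vecMat_identify_mem hC h hf hfS (by simp) (by simp) (by simp) (by simp) h₁ h₂
  let t : ι → Setoid (Fin k) := fun m => identify (s m) x₁ y₁ x₂ y₂
  have h4 : (∑ m, (α m * ((constFns N (t m)).filter fun i => i ∘ f = 0).card) •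
      setoidVec N (Setoid.comap f (t m))) ∈ vecs C 4 := by
    change vecMat _ ∈ C.C 0 4
    refine (congrArg (fun v => vecMat v ∈ C.C 0 4) (funext fun j => ?_)).mpr h3
    simp only [Finset.sum_apply, Pi.smul_apply, smul_eq_mul, ← Finset.sum_filter]
    rw [Finset.sum_comm]
    refine Finset.sum_congr rfl fun m _ => ?_
    rw [← Finset.mul_sum, Finset.sum_filter, sum_identify, mul_assoc]
  have h5 := sum_chords_eq_zero hC hX h4
  have h6 := congrArg (· * ((constFns N crossSetoid).card : ℂ)) h5
  simp only [zero_mul, Finset.sum_mul] at h6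
  refine Eq.trans (Finset.sum_congr rfl fun m _ => ?_) h6
  rw [ite_mul, zero_mul]
  refine if_ctx_congr Iff.rfl (fun hm => ?_) fun _ => rfl
  have hm' : Chords (Setoid.comap f (t m)) 0 1 2 3 := hm
  rw [card_constFns_eq_mul _ f, eq_crossSetoid hm', Nat.cast_mul, mul_assoc]

theorem sum_chords_identify (hC : ∀ a b, NCfam N a b ≤ C.C a b)
    (hX : setoidVec N crossSetoid ∉ vecs C 4)
    [NeZero N] {k : ℕ} {α : ι → ℂ} {s : ι → Setoid (Fin k)}
    (h : (∑ m, α m • setoidVec N (s m)) ∈ vecs C k) {a b c d x₁ y₁ x₂ y₂ : Fin k}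
    (habcd : CycOrdered a b c d)
    (h₁ : CycAdj {a, b, c, d, x₁, y₁, x₂, y₂} x₁ y₁)
    (h₂ : CycAdj {a, b, c, d, x₁, y₁, x₂, y₂} x₂ y₂) :
    (∑ m, if Chords (identify (s m) x₁ y₁ x₂ y₂) a b c d then
      α m * (constFns N (identify (s m) x₁ y₁ x₂ y₂)).card else 0) = 0 := by
  have hrot : ∀ a b c d : Fin k, ({b, c, d, a, x₁, y₁, x₂, y₂} : Finset (Fin k)) =
      {a, b, c, d, x₁, y₁, x₂, y₂} := fun a b c d => by
    ext z
    simp only [Finset.mem_insert]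
    tauto
  rcases habcd with ⟨h1, h2, h3⟩ | ⟨h1, h2, h3⟩ | ⟨h1, h2, h3⟩ | ⟨h1, h2, h3⟩
  · exact sum_chords_identify_of_lt hC hX h h1 h2 h3 h₁ h₂
  · rw [← hrot] at h₁ h₂
    simpa only [chords_rotate] using sum_chords_identify_of_lt hC hX h h1 h2 h3 h₁ h₂
  · rw [← hrot, ← hrot] at h₁ h₂
    simpa only [chords_rotate] using sum_chords_identify_of_lt hC hX h h1 h2 h3 h₁ h₂
  · rw [hrot] at h₁ h₂
    simpa only [chords_rotate] using sum_chords_identify_of_lt hC hX h h1 h2 h3 h₁ h₂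

end Chords

/-! ### Weights of identifications -/

section Split

variable {N k : ℕ}

/-- The proportion of the functions constant on the classes of `s` that respect the
identifications, provided these keep the chords `ac` and `bd` apart. -/
noncomputable def chordWeight {α : Type*} [Fintype α] (N : ℕ) (s : Setoid α)
    (a b c d x₁ y₁ x₂ y₂ : α) : ℚ :=
  if Chords (identify s x₁ y₁ x₂ y₂) a b c d then
    (constFns N (identify s x₁ y₁ x₂ y₂)).card / (constFns N s).card else 0

theorem not_sup_pairSetoid_rel {α : Type*} {s : Setoid α} {x y u v : α} (w : α)
    (hxy : s x w ↔ s y w) (huv : ¬ (s u w ↔ s v w)) : ¬ (s ⊔ pairSetoid x y) u v := by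
  intro h
  have hle : s ⊔ pairSetoid x y ≤ Setoid.ker fun z => s z w :=
    sup_le (fun z z' hz => propext ⟨fun h => s.trans (s.symm hz) h, fun h => s.trans hz h⟩)
      (pairSetoid_le.2 (propext hxy))
  exact huv (iff_of_eq (hle h))

theorem identify_of_rel {α : Type*} {s : Setoid α} {x₁ y₁ x₂ y₂ : α}
    (h : (s ⊔ pairSetoid x₁ y₁) x₂ y₂) : identify s x₁ y₁ x₂ y₂ = s ⊔ pairSetoid x₁ y₁ :=
  sup_pairSetoid_of_rel h

section

variable {α : Type*} [Fintype α] {s : Setoid α} {a b c d x₁ y₁ x₂ y₂ : α}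

theorem chordWeight_nonneg : 0 ≤ chordWeight N s a b c d x₁ y₁ x₂ y₂ := by
  unfold chordWeight
  positivity

theorem constFns_card_ne_zero [NeZero N] : ((constFns N s).card : ℚ) ≠ 0 :=
  Nat.cast_ne_zero.2 (constFns_card_pos s).ne'

theorem chordWeight_of_rel [NeZero N] (h₁ : s x₁ y₁) (h₂ : s x₂ y₂) :
    chordWeight N s a b c d x₁ y₁ x₂ y₂ = if Chords s a b c d then 1 else 0 := by
  have h : identify s x₁ y₁ x₂ y₂ = s := by
    rw [identify, sup_pairSetoid_of_rel h₁, sup_pairSetoid_of_rel h₂]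
  rw [chordWeight, h, div_self constFns_card_ne_zero]

theorem card_sup_pair_div [NeZero N] (h₁ : ¬ s x₁ y₁) :
    ((constFns N (s ⊔ pairSetoid x₁ y₁)).card : ℚ) / (constFns N s).card = 1 / N := by
  have h0 : (N : ℚ) ≠ 0 := Nat.cast_ne_zero.2 (NeZero.ne N)
  have h := constFns_card_ne_zero (N := N) (s := s ⊔ pairSetoid x₁ y₁)
  rw [card_constFns_sup_pair h₁, Nat.cast_mul]
  field_simp

theorem chordWeight_of_not_rel [NeZero N] (h₁ : ¬ s x₁ y₁)
    (h₂ : (s ⊔ pairSetoid x₁ y₁) x₂ y₂) :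
    chordWeight N s a b c d x₁ y₁ x₂ y₂ =
      if Chords (s ⊔ pairSetoid x₁ y₁) a b c d then 1 / (N : ℚ) else 0 := by
  rw [chordWeight, identify_of_rel h₂, card_sup_pair_div h₁]

theorem chordWeight_le_of_not_rel [NeZero N] (h₁ : ¬ s x₁ y₁)
    (h₂ : (s ⊔ pairSetoid x₁ y₁) x₂ y₂) :
    chordWeight N s a b c d x₁ y₁ x₂ y₂ ≤ 1 / (N : ℚ) := by
  rw [chordWeight_of_not_rel h₁ h₂]
  split_ifs
  · exact le_rfl
  · positivity

theorem chordWeight_le_of_not_rel_not_rel [NeZero N] (h₁ : ¬ s x₁ y₁)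
    (h₂ : ¬ (s ⊔ pairSetoid x₁ y₁) x₂ y₂) :
    chordWeight N s a b c d x₁ y₁ x₂ y₂ ≤ 1 / (N : ℚ) * (1 / (N : ℚ)) := by
  unfold chordWeight
  split_ifs
  · rw [identify,
      ← div_mul_div_cancel₀ (constFns_card_ne_zero (N := N) (s := s ⊔ pairSetoid x₁ y₁)),
      card_sup_pair_div h₁, card_sup_pair_div h₂]
  · positivity

end

/-! ### Partitions with additive weights -/

/-- The chord weights of `p` are the sums of those of `q` and `r`. -/
def IsSplit (N : ℕ) (p q r : Setoid (Fin k)) : Prop :=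
  ∀ a b c d x₁ y₁ x₂ y₂ : Fin k, CycOrdered a b c d →
    CycAdj {a, b, c, d, x₁, y₁, x₂, y₂} x₁ y₁ → CycAdj {a, b, c, d, x₁, y₁, x₂, y₂} x₂ y₂ →
      chordWeight N p a b c d x₁ y₁ x₂ y₂ =
        chordWeight N q a b c d x₁ y₁ x₂ y₂ + chordWeight N r a b c d x₁ y₁ x₂ y₂

/-- `x` lies strictly between `a` and `b` in the cyclic order. -/
def CycBetween (a x b : Fin k) : Prop := (a < x ∧ x < b) ∨ (x < b ∧ b < a) ∨ (b < a ∧ a < x)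

theorem CycOrdered.rotate {a b c d : Fin k} (h : CycOrdered a b c d) : CycOrdered b c d a := by
  unfold CycOrdered at *
  tauto

theorem CycOrdered.cases {a b c d : Fin k} (h : CycOrdered a b c d) (x : Fin k) :
    (x = a ∨ x = b ∨ x = c ∨ x = d) ∨
      CycBetween a x b ∨ CycBetween b x c ∨ CycBetween c x d ∨ CycBetween d x a := by
  unfold CycOrdered at h
  unfold CycBetween
  rcases h with h | h | h | h <;> omega

theorem cycAdj_of_not_between {S : Finset (Fin k)} {x y : Fin k}
    (h : ∀ z ∈ S, ¬ CycBetween x z y) : CycAdj S x y := by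
  rcases lt_trichotomy x y with hxy | hxy | hxy
  · refine Or.inr (Or.inl ⟨hxy, fun z hz => ?_⟩)
    have := h z hz
    unfold CycBetween at this
    omega
  · exact Or.inl hxy
  · refine Or.inr (Or.inr (Or.inr (Or.inr fun z hz => ?_)))
    have := h z hz
    unfold CycBetween at this
    omega

theorem CycAdj.symm {S : Finset (Fin k)} {x y : Fin k} (h : CycAdj S x y) : CycAdj S y x := by
  rcases h with h | h | h | h | h
  · exact Or.inl h.symm
  · exact Or.inr (Or.inr (Or.inl h))
  · exact Or.inr (Or.inl h)
  · exact Or.inr (Or.inr (Or.inr (Or.inr h)))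
  · exact Or.inr (Or.inr (Or.inr (Or.inl h)))

theorem CycOrdered.cycAdj_or {a b c d : Fin k} (h : CycOrdered a b c d) (x : Fin k) :
    CycAdj {a, b, c, d, x, a, x, x} x a ∨ CycAdj {a, b, c, d, x, c, x, x} x c := by
  have key : (x = a ∨ x = c) ∨
      ((∀ z ∈ ({a, b, c, d, x, a, x, x} : Finset (Fin k)), ¬ CycBetween a z x) ∨
        ∀ z ∈ ({a, b, c, d, x, a, x, x} : Finset (Fin k)), ¬ CycBetween x z a) ∨
      (∀ z ∈ ({a, b, c, d, x, c, x, x} : Finset (Fin k)), ¬ CycBetween c z x) ∨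
        ∀ z ∈ ({a, b, c, d, x, c, x, x} : Finset (Fin k)), ¬ CycBetween x z c := by
    have hx := h.cases x
    unfold CycOrdered at h
    unfold CycBetween at *
    simp only [Finset.forall_mem_insert, Finset.mem_singleton, forall_eq]
    rcases h with h | h | h | h <;> rcases hx with (hx | hx | hx | hx) | hx | hx | hx | hx <;>
      try subst hx
    all_goals first
      | (exact Or.inl (Or.inl rfl))
      | (exact Or.inl (Or.inr rfl))
      | (refine Or.inr (Or.inl (Or.inl ?_)); omega)
      | (refine Or.inr (Or.inl (Or.inr ?_)); omega)
      | (refine Or.inr (Or.inr (Or.inl ?_)); omega)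
      | (refine Or.inr (Or.inr (Or.inr ?_)); omega)
  rcases key with (h | h) | (h | h) | h | h
  · exact Or.inl (Or.inl h)
  · exact Or.inr (Or.inl h)
  · exact Or.inl (cycAdj_of_not_between h).symm
  · exact Or.inl (cycAdj_of_not_between h)
  · exact Or.inr (cycAdj_of_not_between h).symm
  · exact Or.inr (cycAdj_of_not_between h)

theorem CycBetween.cycAdj {a b c d x y : Fin k} (h : CycOrdered a b c d) (hx : CycBetween a x b)
    (hy : CycBetween a y b) : CycAdj {a, b, c, d, x, y, x, x} x y := by
  have key : ∀ x y, CycBetween a x b → CycBetween a y b → CycBetween a x y →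
      ∀ z ∈ ({a, b, c, d, x, y, x, x} : Finset (Fin k)), ¬ CycBetween x z y := by
    clear hx hy x y
    intro x y hx hy hxy
    unfold CycOrdered at h
    unfold CycBetween at *
    simp only [Finset.forall_mem_insert, Finset.mem_singleton, forall_eq]
    refine ⟨?_, ?_, ?_, ?_, ?_, ?_, ?_, ?_⟩ <;> omega
  have hxy : x = y ∨ CycBetween a x y ∨ CycBetween a y x := by
    unfold CycOrdered at h
    unfold CycBetween at *
    omega
  rcases hxy with hxy | hxy | hxy
  · exact Or.inl hxy
  · exact cycAdj_of_not_between (key x y hx hy hxy)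
  · have hS : ({a, b, c, d, x, y, x, x} : Finset (Fin k)) = {a, b, c, d, y, x, y, y} := by
      ext z
      simp only [Finset.mem_insert, Finset.mem_singleton]
      tauto
    rw [hS]
    exact (cycAdj_of_not_between (key y x hy hx hxy)).symm

theorem CycBetween.cycAdj_left {a b c d x y : Fin k} (h : CycOrdered a b c d)
    (hx : CycBetween a x b) (hy : CycBetween b y c) : CycAdj {a, b, c, d, a, x, y, c} a x := by
  refine cycAdj_of_not_between ?_
  unfold CycOrdered at h
  unfold CycBetween at *
  simp only [Finset.forall_mem_insert, Finset.mem_singleton, forall_eq]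
  refine ⟨?_, ?_, ?_, ?_, ?_, ?_, ?_, ?_⟩ <;> omega

theorem CycBetween.cycAdj_right {a b c d x y : Fin k} (h : CycOrdered a b c d)
    (hx : CycBetween a x b) (hy : CycBetween b y c) : CycAdj {a, b, c, d, a, x, y, c} y c := by
  refine cycAdj_of_not_between ?_
  unfold CycOrdered at h
  unfold CycBetween at *
  simp only [Finset.forall_mem_insert, Finset.mem_singleton, forall_eq]
  refine ⟨?_, ?_, ?_, ?_, ?_, ?_, ?_, ?_⟩ <;> omega

theorem CycOrdered.replace_adjacent {a b c d x y : Fin k} (h : CycOrdered a b c d)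
    (hx : CycBetween a x b) (hy : CycBetween b y c ∨ CycBetween c y d) : CycOrdered x b y d := by
  unfold CycOrdered at *
  unfold CycBetween at hx hy
  rcases h with h | h | h | h <;> rcases hx with hx | hx | hx <;>
    rcases hy with (hy | hy | hy) | (hy | hy | hy) <;> omega

theorem CycOrdered.replace_opposite {a b c d x y : Fin k} (h : CycOrdered a b c d)
    (hx : CycBetween a x b) (hy : CycBetween c y d) : CycOrdered a x c y := by
  unfold CycOrdered at *
  unfold CycBetween at hx hy
  rcases h with h | h | h | h <;> rcases hx with hx | hx | hx <;>
    rcases hy with hy | hy | hy <;> omega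

theorem one_div_natCast_le_one_third {N : ℕ} (hN : 3 ≤ N) : 1 / (N : ℚ) ≤ 1 / 3 :=
  one_div_le_one_div_of_le (by norm_num) (by exact_mod_cast hN)

namespace IsSplit

variable {p q r : Setoid (Fin k)} {a b c d x y : Fin k}

theorem symm (h : IsSplit N p q r) : IsSplit N p r q := fun a b c d x₁ y₁ x₂ y₂ hc h₁ h₂ =>
  (h a b c d x₁ y₁ x₂ y₂ hc h₁ h₂).trans (add_comm _ _)

variable [NeZero N]

theorem ite_chords (h : IsSplit N p q r) (hc : CycOrdered a b c d) :
    (if Chords p a b c d then (1 : ℚ) else 0) =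
      (if Chords q a b c d then 1 else 0) + if Chords r a b c d then 1 else 0 := by
  have := h a b c d a a a a hc (Or.inl rfl) (Or.inl rfl)
  rwa [chordWeight_of_rel (p.refl a) (p.refl a), chordWeight_of_rel (q.refl a) (q.refl a),
    chordWeight_of_rel (r.refl a) (r.refl a)] at this

theorem chords_iff (h : IsSplit N p q r) (hc : CycOrdered a b c d) :
    Chords p a b c d ↔ Chords q a b c d ∨ Chords r a b c d := by
  have := h.ite_chords hc
  split_ifs at this <;> simp_all
  norm_num at this

theorem not_chords (h : IsSplit N p q r) (hc : CycOrdered a b c d) (hq : Chords q a b c d) :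
    ¬ Chords r a b c d := by
  intro hr
  have := h.ite_chords hc
  rw [if_pos hq, if_pos hr] at this
  split_ifs at this <;> norm_num at this

theorem rel_iff_of_cycAdj (hN : 3 ≤ N) (h : IsSplit N p q r) (hc : CycOrdered a b c d)
    (hq : Chords q a b c d) (hxy : CycAdj {a, b, c, d, x, y, x, x} x y) : p x y ↔ q x y := by
  have hN' := one_div_natCast_le_one_third hN
  have hp := (h.chords_iff hc).2 (Or.inl hq)
  have hr := h.not_chords hc hq
  have hw := h a b c d x y x x hc hxy (Or.inl rfl)
  by_cases hpxy : p x y <;> by_cases hqxy : q x y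
  · exact iff_of_true hpxy hqxy
  · have hq' := chordWeight_le_of_not_rel (N := N) (a := a) (b := b) (c := c) (d := d) hqxy
      ((q ⊔ pairSetoid x y).refl x)
    rw [chordWeight_of_rel hpxy (p.refl x), if_pos hp] at hw
    by_cases hrxy : r x y
    · rw [chordWeight_of_rel hrxy (r.refl x), if_neg hr] at hw
      linarith
    · have hr' := chordWeight_le_of_not_rel (N := N) (a := a) (b := b) (c := c) (d := d) hrxy
        ((r ⊔ pairSetoid x y).refl x)
      linarith
  · have hp' := chordWeight_le_of_not_rel (N := N) (a := a) (b := b) (c := c) (d := d) hpxy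
      ((p ⊔ pairSetoid x y).refl x)
    have hr' := chordWeight_nonneg (N := N) (s := r) (a := a) (b := b) (c := c) (d := d)
      (x₁ := x) (y₁ := y) (x₂ := x) (y₂ := x)
    rw [chordWeight_of_rel hqxy (q.refl x), if_pos hq] at hw
    linarith
  · exact iff_of_false hpxy hqxy

theorem rel_first_iff (hN : 3 ≤ N) (h : IsSplit N p q r) (hc : CycOrdered a b c d)
    (hq : Chords q a b c d) (x : Fin k) : p x a ↔ q x a := by
  rcases hc.cycAdj_or x with hx | hx
  · exact h.rel_iff_of_cycAdj hN hc hq hx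
  · have hp := (h.chords_iff hc).2 (Or.inl hq)
    have hxc := h.rel_iff_of_cycAdj hN hc hq hx
    exact ⟨fun hxa => q.trans (hxc.1 (p.trans hxa hp.1)) (q.symm hq.1),
      fun hxa => p.trans (hxc.2 (q.trans hxa hq.1)) (p.symm hp.1)⟩

theorem rel_corner_iff (hN : 3 ≤ N) (h : IsSplit N p q r) (hc : CycOrdered a b c d)
    (hq : Chords q a b c d) (x : Fin k) :
    (p x a ↔ q x a) ∧ (p x b ↔ q x b) ∧ (p x c ↔ q x c) ∧ (p x d ↔ q x d) :=
  ⟨h.rel_first_iff hN hc hq x, h.rel_first_iff hN hc.rotate hq.rotate x,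
    h.rel_first_iff hN hc.rotate.rotate hq.rotate.rotate x,
    h.rel_first_iff hN hc.rotate.rotate.rotate hq.rotate.rotate.rotate x⟩

theorem rel_of_rel_right (hN : 3 ≤ N) (h : IsSplit N p q r) (hc : CycOrdered a b c d)
    (hq : Chords q a b c d) (hx : CycBetween a x b) (hy : CycBetween b y c ∨ CycBetween c y d)
    (hxy : q x y) : p x y := by
  by_cases hxb : q x b
  · exact p.trans ((h.rel_corner_iff hN hc hq x).2.1.2 hxb)
      (p.symm ((h.rel_corner_iff hN hc hq y).2.1.2 (q.trans (q.symm hxy) hxb)))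
  · exact ((h.chords_iff (hc.replace_adjacent hx hy)).2 (Or.inl ⟨hxy, hq.2.1, hxb⟩)).1

/-- A relation `x ~ y` of `p` that fails in `q` avoids the chords of `q`, hence crosses them in
`r`. -/
theorem chords_of_rel_of_not_rel (hN : 3 ≤ N) (h : IsSplit N p q r) (hc : CycOrdered a b c d)
    (hq : Chords q a b c d) (hx : CycBetween a x b) (hy : CycBetween b y c ∨ CycBetween c y d)
    (hp : p x y) (hqxy : ¬ q x y) :
    ¬ p x a ∧ ¬ p x b ∧ Chords r x b y d := by
  have hpc := (h.chords_iff hc).2 (Or.inl hq)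
  obtain ⟨hxa, hxb, -⟩ := h.rel_corner_iff hN hc hq x
  obtain ⟨hya, hyb, -⟩ := h.rel_corner_iff hN hc hq y
  have hna : ¬ p x a := fun hp' =>
    hqxy (q.trans (hxa.1 hp') (q.symm (hya.1 (p.trans (p.symm hp) hp'))))
  have hnb : ¬ p x b := fun hp' =>
    hqxy (q.trans (hxb.1 hp') (q.symm (hyb.1 (p.trans (p.symm hp) hp'))))
  refine ⟨hna, hnb, ?_⟩
  exact ((h.chords_iff (hc.replace_adjacent hx hy)).1 ⟨hp, hpc.2.1, hnb⟩).resolve_left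
    fun hq' => hqxy hq'.1

theorem rel_iff_of_adjacent (hN : 3 ≤ N) (h : IsSplit N p q r) (hc : CycOrdered a b c d)
    (hq : Chords q a b c d) (hx : CycBetween a x b) (hy : CycBetween b y c) :
    p x y ↔ q x y := by
  refine ⟨fun hp => ?_, h.rel_of_rel_right hN hc hq hx (Or.inl hy)⟩
  by_contra hqxy
  obtain ⟨hxa, hxb, hr⟩ := h.chords_of_rel_of_not_rel hN hc hq hx (Or.inl hy) hp hqxy
  have hpc := (h.chords_iff hc).2 (Or.inl hq)
  have hcorner := h.symm.rel_corner_iff hN (hc.replace_adjacent hx (Or.inl hy)) hr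
  have hpax : ¬ p a x := fun h' => hxa (p.symm h')
  have hpcx : ¬ p c x := fun h' => hpax (p.trans hpc.1 h')
  have hqax : ¬ q a x := fun h' => hxa ((h.rel_corner_iff hN hc hq x).1.2 (q.symm h'))
  have hqya : ¬ q y a := fun h' =>
    hxa (p.trans hp ((h.rel_corner_iff hN hc hq y).1.2 h'))
  have hqyc : ¬ q y c := fun h' => hqya (q.trans h' (q.symm hq.1))
  have hrax : ¬ r a x := fun h' => hpax ((hcorner a).1.2 h')
  have hrcx : ¬ r c x := fun h' => hpcx ((hcorner c).1.2 h')
  have hrcy : ¬ r c y := fun h' => hpcx (p.trans ((hcorner c).2.2.1.2 h') (p.symm hp))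
  have hrac : ¬ r a c := fun h' =>
    h.not_chords hc hq ⟨h', hr.2.1, fun hab => hpc.2.2 ((hcorner a).2.1.2 hab)⟩
  have hw := h a b c d a x y c hc (hx.cycAdj_left hc hy) (hx.cycAdj_right hc hy)
  have hle : p ≤ p ⊔ pairSetoid a x := le_sup_left
  have hax : (p ⊔ pairSetoid a x) a x := pairSetoid_le.1 le_sup_right
  have hyc : (p ⊔ pairSetoid a x) y c :=
    Setoid.trans' _ (hle (p.symm hp)) (Setoid.trans' _ (Setoid.symm' _ hax) (hle hpc.1))
  have hab : ¬ (p ⊔ pairSetoid a x) a b :=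
    not_sup_pairSetoid_rel b (iff_of_false hpc.2.2 hxb) fun h' => hpc.2.2 (h'.2 (p.refl b))
  rw [chordWeight_of_not_rel hpax hyc, if_pos ⟨hle hpc.1, hle hpc.2.1, hab⟩] at hw
  have hwq := chordWeight_le_of_not_rel_not_rel (N := N) (a := a) (b := b) (c := c) (d := d) hqax
    (not_sup_pairSetoid_rel (u := y) (v := c) y
      (iff_of_false (fun h' => hqya (q.symm h')) hqxy)
      fun h' => hqyc (q.symm (h'.1 (q.refl y))))
  have hwr := chordWeight_le_of_not_rel_not_rel (N := N) (a := a) (b := b) (c := c) (d := d) hrax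
    (not_sup_pairSetoid_rel (u := y) (v := c) c
      (iff_of_false hrac fun h' => hrcx (r.symm h'))
      fun h' => hrcy (r.symm (h'.2 (r.refl c))))
  have hN' := one_div_natCast_le_one_third hN
  have hpos : 0 < 1 / (N : ℚ) := one_div_pos.2 (Nat.cast_pos.2 (by omega))
  nlinarith

theorem rel_iff_of_opposite (hN : 3 ≤ N) (h : IsSplit N p q r) (hc : CycOrdered a b c d)
    (hq : Chords q a b c d) (hx : CycBetween a x b) (hy : CycBetween c y d) :
    p x y ↔ q x y := by
  refine ⟨fun hp => ?_, h.rel_of_rel_right hN hc hq hx (Or.inr hy)⟩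
  by_contra hqxy
  obtain ⟨hxa, -, hr⟩ := h.chords_of_rel_of_not_rel hN hc hq hx (Or.inr hy) hp hqxy
  have hpc := (h.chords_iff hc).2 (Or.inl hq)
  have hrac : r a c :=
    (((h.chords_iff (hc.replace_opposite hx hy)).1
      ⟨hpc.1, hp, fun h' => hxa (p.symm h')⟩).resolve_left fun hq' => hqxy hq'.2.1).1
  have hcorner := h.symm.rel_corner_iff hN (hc.replace_adjacent hx (Or.inr hy)) hr
  exact h.not_chords hc hq ⟨hrac, hr.2.1, fun hab => hpc.2.2 ((hcorner a).2.1.2 hab)⟩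

theorem rel_iff_of_between (hN : 3 ≤ N) (h : IsSplit N p q r) (hc : CycOrdered a b c d)
    (hq : Chords q a b c d) (hx : CycBetween a x b) (y : Fin k) : p x y ↔ q x y := by
  obtain ⟨ha, hb, hc', hd⟩ := h.rel_corner_iff hN hc hq x
  rcases hc.cases y with (rfl | rfl | rfl | rfl) | hy | hy | hy | hy
  · exact ha
  · exact hb
  · exact hc'
  · exact hd
  · exact h.rel_iff_of_cycAdj hN hc hq (hx.cycAdj hc hy)
  · exact h.rel_iff_of_adjacent hN hc hq hx hy
  · exact h.rel_iff_of_opposite hN hc hq hx hy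
  · rw [p.comm', q.comm']
    exact h.rel_iff_of_adjacent hN hc.rotate.rotate.rotate hq.rotate.rotate.rotate hy hx

theorem eq_of_chords (hN : 3 ≤ N) (h : IsSplit N p q r) (hc : CycOrdered a b c d)
    (hq : Chords q a b c d) : p = q := by
  ext x y
  obtain ⟨ha, hb, hc', hd⟩ := h.rel_corner_iff hN hc hq y
  rcases hc.cases x with (rfl | rfl | rfl | rfl) | hx | hx | hx | hx
  · rwa [p.comm', q.comm']
  · rwa [p.comm', q.comm']
  · rwa [p.comm', q.comm']
  · rwa [p.comm', q.comm']
  · exact h.rel_iff_of_between hN hc hq hx y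
  · exact h.rel_iff_of_between hN hc.rotate hq.rotate hx y
  · exact h.rel_iff_of_between hN hc.rotate.rotate hq.rotate.rotate hx y
  · exact h.rel_iff_of_between hN hc.rotate.rotate.rotate hq.rotate.rotate.rotate hx y

/-- The chords of a split cannot be distributed nontrivially. -/
theorem not_chords_of_chords (hN : 3 ≤ N) (h : IsSplit N p q r) (hc : CycOrdered a b c d)
    (hq : Chords q a b c d) {a' b' c' d' : Fin k} (hc' : CycOrdered a' b' c' d') :
    ¬ Chords r a' b' c' d' := fun hr =>
  h.not_chords hc' (h.eq_of_chords hN hc hq ▸ (h.chords_iff hc').2 (Or.inr hr)) hr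

end IsSplit

end Split

/-! ### Crossings and the main theorem -/

section Crossings

variable {N k : ℕ} {p q r : Finpartition (Finset.univ : Finset (Fin k))} {a b c d : Fin k}

theorem insert_mem_cr_iff (hab : a < b) (hbc : b < c) (hcd : c < d) :
    {a, b, c, d} ∈ cr p ↔ Chords (partSetoid p) a b c d := by
  constructor
  · rintro ⟨a', b', c', d', hab', hbc', hcd', h, hp⟩
    rw [Finset.ext_iff] at h
    simp only [Finset.mem_insert, Finset.mem_singleton] at h
    have ha := h a
    have hb := h b
    have hc := h c
    have hd := h d
    have ha' := h a'
    have hb' := h b'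
    have hc' := h c'
    have hd' := h d'
    obtain ⟨rfl, rfl, rfl, rfl⟩ : a = a' ∧ b = b' ∧ c = c' ∧ d = d' := by
      clear hp h
      refine ⟨?_, ?_, ?_, ?_⟩ <;> omega
    exact hp
  · exact fun h => ⟨a, b, c, d, hab, hbc, hcd, rfl, h⟩

theorem exists_chords_iff_mem_cr (h : CycOrdered a b c d) :
    ∃ κ, ∀ s : Finpartition (Finset.univ : Finset (Fin k)),
      Chords (partSetoid s) a b c d ↔ κ ∈ cr s := by
  rcases h with ⟨h₁, h₂, h₃⟩ | ⟨h₁, h₂, h₃⟩ | ⟨h₁, h₂, h₃⟩ | ⟨h₁, h₂, h₃⟩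
  · exact ⟨_, fun s => (insert_mem_cr_iff h₁ h₂ h₃).symm⟩
  · exact ⟨{b, c, d, a}, fun s => by simp only [insert_mem_cr_iff h₁ h₂ h₃, chords_rotate]⟩
  · exact ⟨{c, d, a, b}, fun s => by simp only [insert_mem_cr_iff h₁ h₂ h₃, chords_rotate]⟩
  · exact ⟨{d, a, b, c}, fun s => by simp only [insert_mem_cr_iff h₁ h₂ h₃, chords_rotate]⟩

theorem exists_chords_of_mem_cr {κ : Finset (Fin k)} (h : κ ∈ cr p) :
    ∃ a b c d, CycOrdered a b c d ∧ Chords (partSetoid p) a b c d := by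
  obtain ⟨a, b, c, d, hab, hbc, hcd, -, hp⟩ := h
  exact ⟨a, b, c, d, Or.inl ⟨hab, hbc, hcd⟩, hp⟩

theorem ite_chords_identify_eq [NeZero N] (s : Setoid (Fin k)) (x₁ y₁ x₂ y₂ : Fin k) (z : ℂ) :
    (if Chords (identify s x₁ y₁ x₂ y₂) a b c d then
      z * (constFns N (identify s x₁ y₁ x₂ y₂)).card else 0) =
      z * (constFns N s).card * chordWeight N s a b c d x₁ y₁ x₂ y₂ := by
  have h : ((constFns N s).card : ℂ) ≠ 0 := Nat.cast_ne_zero.2 (constFns_card_pos s).ne'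
  unfold chordWeight
  split_ifs
  · push_cast
    field_simp
  · simp

/-- If `C` does not contain the crossing, the coefficients of a combination of `p`, `q`, `r` in
`C` force the weights to be additive, unless the combination vanishes. -/
theorem eq_zero_or_isSplit [NeZero N] {C : TKDual N} (hC : ∀ a b, NCfam N a b ≤ C.C a b)
    (hX : setoidVec N crossSetoid ∉ vecs C 4)
    (hunion : cr p = cr q ∪ cr r) (hdisj : cr q ∩ cr r = ∅)
    (hq : (cr q).Nonempty) (hr : (cr r).Nonempty) {α : Fin 3 → ℂ}
    (h : (∑ m, α m • setoidVec N (![partSetoid p, partSetoid q, partSetoid r] m)) ∈ vecs C k) :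
    α = 0 ∨ IsSplit N (partSetoid p) (partSetoid q) (partSetoid r) := by
  have hcard (s : Setoid (Fin k)) : ((constFns N s).card : ℂ) ≠ 0 :=
    Nat.cast_ne_zero.2 (constFns_card_pos s).ne'
  have hsum {a b c d x₁ y₁ x₂ y₂ : Fin k} (hc : CycOrdered a b c d)
      (h₁ : CycAdj {a, b, c, d, x₁, y₁, x₂, y₂} x₁ y₁)
      (h₂ : CycAdj {a, b, c, d, x₁, y₁, x₂, y₂} x₂ y₂) := sum_chords_identify hC hX h hc h₁ h₂
  simp only [ite_chords_identify_eq, Fin.sum_univ_three, Matrix.cons_val] at hsum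
  have hsub {a b c d : Fin k} (hc : CycOrdered a b c d) := hsum hc (x₁ := a) (x₂ := a)
    (Or.inl rfl) (Or.inl rfl)
  simp only [chordWeight_of_rel (Setoid.refl' _ _) (Setoid.refl' _ _)] at hsub
  have hpq : α 0 * (constFns N (partSetoid p)).card +
      α 1 * (constFns N (partSetoid q)).card = 0 := by
    obtain ⟨_, hq⟩ := hq
    obtain ⟨a, b, c, d, hc, hq⟩ := exists_chords_of_mem_cr hq
    obtain ⟨κ, hκ⟩ := exists_chords_iff_mem_cr hc
    have hr : ¬ Chords (partSetoid r) a b c d := fun hr =>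
      (hdisj ▸ ⟨(hκ q).1 hq, (hκ r).1 hr⟩ : κ ∈ (∅ : Set (Finset (Fin k))))
    have hp : Chords (partSetoid p) a b c d := (hκ p).2 (hunion ▸ Or.inl ((hκ q).1 hq))
    have := hsub hc
    rw [if_pos hp, if_pos hq, if_neg hr] at this
    simpa using this
  have hpr : α 0 * (constFns N (partSetoid p)).card +
      α 2 * (constFns N (partSetoid r)).card = 0 := by
    obtain ⟨_, hr⟩ := hr
    obtain ⟨a, b, c, d, hc, hr⟩ := exists_chords_of_mem_cr hr
    obtain ⟨κ, hκ⟩ := exists_chords_iff_mem_cr hc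
    have hq : ¬ Chords (partSetoid q) a b c d := fun hq =>
      (hdisj ▸ ⟨(hκ q).1 hq, (hκ r).1 hr⟩ : κ ∈ (∅ : Set (Finset (Fin k))))
    have hp : Chords (partSetoid p) a b c d := (hκ p).2 (hunion ▸ Or.inr ((hκ r).1 hr))
    have := hsub hc
    rw [if_pos hp, if_neg hq, if_pos hr] at this
    simpa using this
  by_cases h0 : α 0 = 0
  · rw [h0, zero_mul, zero_add] at hpq hpr
    left
    ext m
    fin_cases m
    · exact h0
    · exact (mul_eq_zero.1 hpq).resolve_right (hcard _)
    · exact (mul_eq_zero.1 hpr).resolve_right (hcard _)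
  · right
    intro a b c d x₁ y₁ x₂ y₂ hc h₁ h₂
    have hw := hsum hc h₁ h₂
    rw [eq_neg_of_add_eq_zero_right hpq, eq_neg_of_add_eq_zero_right hpr] at hw
    refine Rat.cast_injective (α := ℂ) (mul_left_cancel₀ (mul_ne_zero h0 (hcard (partSetoid p))) ?_)
    rw [Rat.cast_add]
    linear_combination hw

end Crossings

/-- for `N ≥ 4` and distinct partitions `p, q, r` of `[k]` with
`cr(p)` the disjoint union of the nonempty sets `cr(q)` and `cr(r)`, and nonzero
`ξ = α₁ ξ_p + α₂ ξ_q + α₃ ξ_r`, the Tannaka–Krein dual `⟨NC, ξ⟩` equals `P`. -/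
theorem stmt18 {N k : ℕ} (hN : 4 ≤ N)
    (p q r : Finpartition (Finset.univ : Finset (Fin k)))
    (hpq : p ≠ q) (hpr : p ≠ r) (hqr : q ≠ r)
    (hunion : cr p = cr q ∪ cr r) (hdisj : cr q ∩ cr r = ∅)
    (hq : (cr q).Nonempty) (hr : (cr r).Nonempty)
    (α₁ α₂ α₃ : ℂ) (ξ : (Fin k → Fin N) → ℂ)
    (hξ : ξ = α₁ • xi N p + α₂ • xi N q + α₃ • xi N r) (hne : ξ ≠ 0) :
    ∀ k' ℓ', genNCxi N ξ k' ℓ' = Pfam N k' ℓ' := by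
  intro k' ℓ'
  have : NeZero N := ⟨by omega⟩
  have hξ' : ξ = ∑ m, ![α₁, α₂, α₃] m •
      setoidVec N (![partSetoid p, partSetoid q, partSetoid r] m) := by
    simp only [hξ, Fin.sum_univ_three, Matrix.cons_val, xi_eq_setoidVec]
  refine le_antisymm ?_ ?_
  · have hmem : ξ ∈ vecs (pfamDual N) k := by
      have hxi (s : Finpartition (Finset.univ : Finset (Fin k))) :
          xi N s ∈ vecs (pfamDual N) k := vecMat_xi_mem_Pfam s
      rw [hξ]
      exact add_mem (add_mem (Submodule.smul_mem _ _ (hxi p)) (Submodule.smul_mem _ _ (hxi q)))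
        (Submodule.smul_mem _ _ (hxi r))
    exact (iInf_le _ (pfamDual N)).trans
      ((iInf_le _ NCfam_le_Pfam).trans (iInf_le _ hmem))
  · refine le_iInf fun C => le_iInf fun hC => le_iInf fun hmem => Pfam_le hC ?_ k' ℓ'
    by_contra hX
    rcases eq_zero_or_isSplit hC hX hunion hdisj hq hr (hξ' ▸ hmem) with hα | hsplit
    · exact hne (by rw [hξ', hα]; simp)
    · obtain ⟨_, hq⟩ := hq
      obtain ⟨_, hr⟩ := hr
      obtain ⟨a, b, c, d, hc, hq⟩ := exists_chords_of_mem_cr hq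
      obtain ⟨a', b', c', d', hc', hr⟩ := exists_chords_of_mem_cr hr
      exact hsplit.not_chords_of_chords (by omega) hc hq hc' hr
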